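/- arXiv:1404.0907 — 5 statements merged into one kernel-verified Lean document; each statement's English description precedes it below -/
import Mathlib

section
/- Let H₁ and H₂ be Hilbert spaces, S ∈ L(H₁,H₂) and T ∈ L(H₂,H₁). If (S,T) is a Fredholm pair, then R(S) and N(T) + R(S) are closed subspaces of H₂, and R(T) and N(S) + R(T) are closed subspaces of H₁. -/
open Module ContinuousLinearMap

noncomputable section

set_option maxHeartbeats 1000000
set_option synthInstance.maxHeartbeats 1000000

/-- For submodules `p q` of a space `E`, the quotient space `p / (p ⊓ q)`. -/
abbrev relQuot {E : Type*} [AddCommGroup E] [Module ℂ E] (p q : Submodule ℂ E) : Type _ :=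
  ↥p ⧸ ((p ⊓ q).comap p.subtype)

section Defs

variable {H₁ H₂ : Type*} [NormedAddCommGroup H₁] [NormedSpace ℂ H₁]
  [NormedAddCommGroup H₂] [NormedSpace ℂ H₂]

/-- `(S, T)` is a Fredholm pair if the four quotients `N(S)/(N(S) ⊓ R(T))`,
`R(T)/(N(S) ⊓ R(T))`, `N(T)/(N(T) ⊓ R(S))`, `R(S)/(N(T) ⊓ R(S))` are finite dimensional. -/
def IsFredholmPair (S : H₁ →L[ℂ] H₂) (T : H₂ →L[ℂ] H₁) : Prop :=
  FiniteDimensional ℂ (relQuot (LinearMap.ker S.toLinearMap) (LinearMap.range T.toLinearMap)) ∧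
  FiniteDimensional ℂ (relQuot (LinearMap.range T.toLinearMap) (LinearMap.ker S.toLinearMap)) ∧
  FiniteDimensional ℂ (relQuot (LinearMap.ker T.toLinearMap) (LinearMap.range S.toLinearMap)) ∧
  FiniteDimensional ℂ (relQuot (LinearMap.range S.toLinearMap) (LinearMap.ker T.toLinearMap))

/-- The index of a Fredholm pair:
`ind (S,T) = dim N(S)/(N(S)⊓R(T)) - dim R(T)/(N(S)⊓R(T)) - dim N(T)/(N(T)⊓R(S)) + dim R(S)/(N(T)⊓R(S))`. -/
def pairIndex (S : H₁ →L[ℂ] H₂) (T : H₂ →L[ℂ] H₁) : ℤ :=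
  (finrank ℂ (relQuot (LinearMap.ker S.toLinearMap) (LinearMap.range T.toLinearMap)) : ℤ)
    - (finrank ℂ (relQuot (LinearMap.range T.toLinearMap) (LinearMap.ker S.toLinearMap)) : ℤ)
    - (finrank ℂ (relQuot (LinearMap.ker T.toLinearMap) (LinearMap.range S.toLinearMap)) : ℤ)
    + (finrank ℂ (relQuot (LinearMap.range S.toLinearMap) (LinearMap.ker T.toLinearMap)) : ℤ)

/-- A bounded operator is Fredholm if its kernel is finite dimensional, its range is closed
and its cokernel is finite dimensional. -/
def IsFredholmOp (A : H₁ →L[ℂ] H₂) : Prop :=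
  FiniteDimensional ℂ (LinearMap.ker A.toLinearMap) ∧ IsClosed (LinearMap.range A.toLinearMap : Set H₂) ∧
  FiniteDimensional ℂ (H₂ ⧸ LinearMap.range A.toLinearMap)

/-- The index of a Fredholm operator: `ind A = dim N(A) - dim H₂/R(A)`. -/
def opIndex (A : H₁ →L[ℂ] H₂) : ℤ :=
  (finrank ℂ (LinearMap.ker A.toLinearMap) : ℤ) - (finrank ℂ (H₂ ⧸ LinearMap.range A.toLinearMap) : ℤ)

end Defs

variable {H₁ H₂ : Type*} [NormedAddCommGroup H₁] [InnerProductSpace ℂ H₁] [CompleteSpace H₁]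
  [NormedAddCommGroup H₂] [InnerProductSpace ℂ H₂] [CompleteSpace H₂]

/-- If `p / (p ⊓ q)` is finite dimensional, then `q` has a finite dimensional complement
in `q ⊔ p`. -/
theorem exists_finiteDimensional_sup_eq_of_relQuot {E : Type*} [AddCommGroup E] [Module ℂ E]
    {p q : Submodule ℂ E} (h : FiniteDimensional ℂ (relQuot p q)) :
    ∃ V : Submodule ℂ E, FiniteDimensional ℂ V ∧ Disjoint q V ∧ q ⊔ V = q ⊔ p := by
  obtain ⟨C, hC⟩ := Submodule.exists_isCompl ((p ⊓ q).comap p.subtype)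
  have : FiniteDimensional ℂ C := (Submodule.quotientEquivOfIsCompl _ C hC).finiteDimensional
  refine ⟨C.map p.subtype, inferInstance, ?_, le_antisymm ?_ ?_⟩
  · rw [Submodule.disjoint_def]
    rintro _ hq ⟨x, hx, rfl⟩
    have := Submodule.disjoint_def.mp hC.disjoint x ⟨x.2, hq⟩ hx
    simp [this]
  · exact sup_le_sup_left (Submodule.map_subtype_le p C) q
  · refine sup_le le_sup_left ?_
    calc p = ((p ⊓ q).comap p.subtype ⊔ C).map p.subtype := by
          rw [hC.sup_eq_top, Submodule.map_subtype_top]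
      _ = ((p ⊓ q).comap p.subtype).map p.subtype ⊔ C.map p.subtype := Submodule.map_sup _ _ _
      _ ≤ q ⊔ C.map p.subtype :=
          sup_le_sup_right ((Submodule.map_comap_le _ _).trans inf_le_right) _

/-- The range of an operator between Banach spaces is closed as soon as it has a closed algebraic
complement in some closed subspace. -/
theorem isClosed_range_of_isClosed_range_sup {𝕜 E F : Type*} [NontriviallyNormedField 𝕜]
    [NormedAddCommGroup E] [NormedSpace 𝕜 E] [CompleteSpace E]
    [NormedAddCommGroup F] [NormedSpace 𝕜 F] [CompleteSpace F]
    (f : E →L[𝕜] F) {V : Submodule 𝕜 F} (hV : IsClosed (V : Set F))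
    (hd : Disjoint (LinearMap.range f.toLinearMap) V)
    (hc : IsClosed ((LinearMap.range f.toLinearMap ⊔ V : Submodule 𝕜 F) : Set F)) :
    IsClosed (LinearMap.range f.toLinearMap : Set F) := by
  have : IsClosed (f.ker : Set E) := f.isClosed_ker
  have : CompleteSpace V := hV.completeSpace_coe
  let g : E ⧸ f.ker →L[𝕜] F := f.ker.liftQL f le_rfl
  have hg_ker : g.ker = ⊥ := by
    simp [g, Submodule.toLinearMap_liftQL, Submodule.ker_liftQ_eq_bot]
  have hg_range : g.range = f.range := by
    simp [g, Submodule.toLinearMap_liftQL, Submodule.range_liftQ]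
  let G : (E ⧸ f.ker) × V →L[𝕜] F := g.coprod V.subtypeL
  have hG_inj : Function.Injective G := by
    suffices G.ker = ⊥ from LinearMap.ker_eq_bot.mp this
    rw [ker_coprod_of_disjoint_range (by simpa [hg_range] using hd), hg_ker]
    simp
  have hG_range : G.range = f.range ⊔ V := by
    simp [G, LinearMap.range_coprod, hg_range]
  obtain ⟨K, hK⟩ := G.antilipschitz_of_injective_of_isClosed_range hG_inj
    (by rw [← hG_range] at hc; exact hc)
  have himage : (f.range : Set F) = G '' (Set.univ ×ˢ {0}) := by
    rw [← hg_range]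
    ext y
    simp [G]
  rw [himage]
  exact (hK.isClosedEmbedding G.uniformContinuous).isClosedMap _
    (isClosed_univ.prod isClosed_singleton)

/-- If an operator range is commensurable with a closed subspace `N`, then both the range and its
sum with `N` are closed. -/
theorem isClosed_range_and_sup_of_relQuot {E F : Type*}
    [NormedAddCommGroup E] [NormedSpace ℂ E] [CompleteSpace E]
    [NormedAddCommGroup F] [NormedSpace ℂ F] [CompleteSpace F]
    (f : E →L[ℂ] F) {N : Submodule ℂ F} (hN : IsClosed (N : Set F))
    (h₁ : FiniteDimensional ℂ (relQuot N (LinearMap.range f.toLinearMap)))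
    (h₂ : FiniteDimensional ℂ (relQuot (LinearMap.range f.toLinearMap) N)) :
    IsClosed (LinearMap.range f.toLinearMap : Set F) ∧
    IsClosed ((N ⊔ LinearMap.range f.toLinearMap : Submodule ℂ F) : Set F) := by
  obtain ⟨V, hV, hVd, hVs⟩ := exists_finiteDimensional_sup_eq_of_relQuot h₁
  obtain ⟨W, hW, -, hWs⟩ := exists_finiteDimensional_sup_eq_of_relQuot h₂
  have hsup : IsClosed ((N ⊔ LinearMap.range f.toLinearMap : Submodule ℂ F) : Set F) :=
    hWs ▸ N.isClosed_sup_finiteDimensional W hN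
  refine ⟨isClosed_range_of_isClosed_range_sup f V.closed_of_finiteDimensional hVd ?_, hsup⟩
  rwa [hVs, sup_comm]

theorem fredholm_pair_closed_ranges (S : H₁ →L[ℂ] H₂) (T : H₂ →L[ℂ] H₁)
    (h : IsFredholmPair S T) :
    IsClosed (LinearMap.range S.toLinearMap : Set H₂) ∧
    IsClosed ((LinearMap.ker T.toLinearMap ⊔ LinearMap.range S.toLinearMap : Submodule ℂ H₂) : Set H₂) ∧
    IsClosed (LinearMap.range T.toLinearMap : Set H₁) ∧
    IsClosed ((LinearMap.ker S.toLinearMap ⊔ LinearMap.range T.toLinearMap : Submodule ℂ H₁) : Set H₁) := by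
  obtain ⟨hS₁, hT₁, hT₂, hS₂⟩ := h
  obtain ⟨hS, hTS⟩ := isClosed_range_and_sup_of_relQuot S T.isClosed_ker hT₂ hS₂
  obtain ⟨hT, hST⟩ := isClosed_range_and_sup_of_relQuot T S.isClosed_ker hS₁ hT₁
  exact ⟨hS, hTS, hT, hST⟩
end
end

section
/- Let H₁ and H₂ be Hilbert spaces and let S ∈ L(H₁,H₂) and T ∈ L(H₂,H₁) be such that F₁ = R(TS) and F₂ = R(ST) are finite-dimensional subspaces of H₁ and H₂ respectively. Write H₁ = F₁ ⊕ 𝓗₁ and H₂ = F₂ ⊕ 𝓗₂ with 𝓗ᵢ = Fᵢ^⊥, let Pᵢ : Hᵢ → 𝓗ᵢ denote the orthogonal projection onto 𝓗ᵢ, and define 𝒮 = P₂ ∘ (S|𝓗₁) ∈ L(𝓗₁,𝓗₂) and 𝒯 = P₁ ∘ (T|𝓗₂) ∈ L(𝓗₂,𝓗₁). Then 𝒮𝒯 = 0 and 𝒯𝒮 = 0; moreover (S,T) is a Fredholm pair if and only if (𝒮,𝒯) is a Fredholm pair, and in this case ind(S,T) = ind(𝒮,𝒯) − dim R(ST) +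 dim R(TS). -/
open Module ContinuousLinearMap

noncomputable section

set_option maxHeartbeats 1000000
set_option synthInstance.maxHeartbeats 1000000

variable {H₁ H₂ : Type*} [NormedAddCommGroup H₁] [InnerProductSpace ℂ H₁] [CompleteSpace H₁]
  [NormedAddCommGroup H₂] [InnerProductSpace ℂ H₂] [CompleteSpace H₂]

/-- The compression `𝒮 = P₂ ∘ (S | 𝓗₁) : 𝓗₁ → 𝓗₂` of `S`, where `𝓗₁ = R(TS)ᗮ`,
`𝓗₂ = R(ST)ᗮ` and `P₂` is the orthogonal projection onto `𝓗₂`. -/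
def calS (S : H₁ →L[ℂ] H₂) (T : H₂ →L[ℂ] H₁) :
    ↥((LinearMap.range (T ∘L S).toLinearMap)ᗮ) →L[ℂ] ↥((LinearMap.range (S ∘L T).toLinearMap)ᗮ) :=
  Submodule.orthogonalProjection (LinearMap.range (S ∘L T).toLinearMap)ᗮ ∘L
    (S ∘L ((LinearMap.range (T ∘L S).toLinearMap)ᗮ).subtypeL)

/-- The compression `𝒯 = P₁ ∘ (T | 𝓗₂) : 𝓗₂ → 𝓗₁` of `T`. -/
def calT (S : H₁ →L[ℂ] H₂) (T : H₂ →L[ℂ] H₁) :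
    ↥((LinearMap.range (S ∘L T).toLinearMap)ᗮ) →L[ℂ] ↥((LinearMap.range (T ∘L S).toLinearMap)ᗮ) :=
  Submodule.orthogonalProjection (LinearMap.range (T ∘L S).toLinearMap)ᗮ ∘L
    (T ∘L ((LinearMap.range (S ∘L T).toLinearMap)ᗮ).subtypeL)

lemma relQuot_mkQ_eq_zero_iff {E : Type*} [AddCommGroup E] [Module ℂ E] (p q : Submodule ℂ E)
    (x : p) : ((p ⊓ q).comap p.subtype).mkQ x = 0 ↔ (x : E) ∈ q := by
  rw [Submodule.mkQ_apply, Submodule.Quotient.mk_eq_zero]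
  simp

lemma nonempty_relQuot_equiv {E W : Type*} [AddCommGroup E] [Module ℂ E] [AddCommGroup W]
    [Module ℂ W] (p q : Submodule ℂ E) (g : ↥p →ₗ[ℂ] W) (hg : Function.Surjective g)
    (hker : ∀ x : p, g x = 0 ↔ (x : E) ∈ q) : Nonempty (relQuot p q ≃ₗ[ℂ] W) := by
  have h : (p ⊓ q).comap p.subtype = LinearMap.ker g := by
    ext x
    simp [hker]
  exact ⟨(Submodule.quotEquivOfEq _ _ h).trans (g.quotKerEquivOfSurjective hg)⟩

/-- `R(T) / (N(S) ⊓ R(T))` is isomorphic to `R(ST)`. -/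
lemma nonempty_relQuot_range_ker_equiv {E F : Type*} [NormedAddCommGroup E] [NormedSpace ℂ E]
    [NormedAddCommGroup F] [NormedSpace ℂ F] (S : E →L[ℂ] F) (T : F →L[ℂ] E) :
    Nonempty (relQuot (LinearMap.range T.toLinearMap) (LinearMap.ker S.toLinearMap) ≃ₗ[ℂ]
      LinearMap.range (S ∘L T).toLinearMap) := by
  refine nonempty_relQuot_equiv _ _
    ((S.toLinearMap ∘ₗ (LinearMap.range T.toLinearMap).subtype).codRestrict
      (LinearMap.range (S ∘L T).toLinearMap) ?_) ?_ ?_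
  · rintro ⟨_, z, rfl⟩
    exact ⟨z, rfl⟩
  · rintro ⟨_, z, rfl⟩
    exact ⟨⟨T z, z, rfl⟩, rfl⟩
  · intro x
    rw [← Subtype.coe_inj]
    rfl

lemma orthogonalProjection_orthogonal_eq_zero_iff {E : Type*} [NormedAddCommGroup E]
    [InnerProductSpace ℂ E] (K : Submodule ℂ E) [K.HasOrthogonalProjection] (x : E) :
    Submodule.orthogonalProjectionOnto Kᗮ x = 0 ↔ x ∈ K := by
  rw [Submodule.orthogonalProjectionOnto_eq_zero_iff, Submodule.orthogonal_orthogonal]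

lemma sub_orthogonalProjection_orthogonal_mem {E : Type*} [NormedAddCommGroup E]
    [InnerProductSpace ℂ E] (K : Submodule ℂ E) [K.HasOrthogonalProjection] (x : E) :
    x - (Submodule.orthogonalProjectionOnto Kᗮ x : E) ∈ K := by
  rw [← orthogonalProjection_orthogonal_eq_zero_iff, map_sub,
    Submodule.orthogonalProjectionOnto_mem_subspace_eq_self, sub_self]

section Compression

variable (S : H₁ →L[ℂ] H₂) (T : H₂ →L[ℂ] H₁)
  [FiniteDimensional ℂ (LinearMap.range (T ∘L S).toLinearMap)]
  [FiniteDimensional ℂ (LinearMap.range (S ∘L T).toLinearMap)]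

set_option linter.unusedSectionVars false in
/-- The compression intertwines `S` with the projections, since `S` maps `R(TS)` into `R(ST)`. -/
lemma calS_orthogonalProjection (x : H₁) :
    calS S T (Submodule.orthogonalProjectionOnto (LinearMap.range (T ∘L S).toLinearMap)ᗮ x) =
      Submodule.orthogonalProjectionOnto (LinearMap.range (S ∘L T).toLinearMap)ᗮ (S x) := by
  obtain ⟨z, hz⟩ :=
    sub_orthogonalProjection_orthogonal_mem (LinearMap.range (T ∘L S).toLinearMap) x
  symm
  rw [← sub_eq_zero]
  change Submodule.orthogonalProjectionOnto _ (S x) - Submodule.orthogonalProjectionOnto _ (S _) = 0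
  rw [← map_sub, ← map_sub, orthogonalProjection_orthogonal_eq_zero_iff]
  exact ⟨S z, congrArg S hz⟩

set_option linter.unusedSectionVars false in
lemma calT_orthogonalProjection (y : H₂) :
    calT S T (Submodule.orthogonalProjectionOnto (LinearMap.range (S ∘L T).toLinearMap)ᗮ y) =
      Submodule.orthogonalProjectionOnto (LinearMap.range (T ∘L S).toLinearMap)ᗮ (T y) :=
  calS_orthogonalProjection T S y

lemma calS_comp_calT : calS S T ∘L calT S T = 0 := by
  ext1 y
  change calS S T (Submodule.orthogonalProjectionOnto _ (T y)) = 0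
  rw [calS_orthogonalProjection, orthogonalProjection_orthogonal_eq_zero_iff]
  exact ⟨y, rfl⟩

lemma nonempty_relQuot_ker_range_equiv :
    Nonempty (relQuot (LinearMap.ker S.toLinearMap) (LinearMap.range T.toLinearMap) ≃ₗ[ℂ]
      relQuot (LinearMap.ker (calS S T).toLinearMap)
        (LinearMap.range (calT S T).toLinearMap)) := by
  set P := Submodule.orthogonalProjectionOnto (LinearMap.range (T ∘L S).toLinearMap)ᗮ with hP
  have hmem (x : LinearMap.ker S.toLinearMap) :
      P x ∈ LinearMap.ker (calS S T).toLinearMap := by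
    have hx : S x = 0 := x.2
    change calS S T (P x) = 0
    rw [hP, calS_orthogonalProjection, hx, map_zero]
  refine nonempty_relQuot_equiv _ _
    (Submodule.mkQ _ ∘ₗ (P.toLinearMap ∘ₗ (LinearMap.ker S.toLinearMap).subtype).codRestrict
      (LinearMap.ker (calS S T).toLinearMap) hmem) ?_ ?_
  · intro w
    obtain ⟨⟨y, hy⟩, rfl⟩ := Submodule.mkQ_surjective _ w
    obtain ⟨z, hz⟩ := (orthogonalProjection_orthogonal_eq_zero_iff _ (S y)).1 hy
    have hz' : S (T z) = S y := hz
    refine ⟨⟨y - T z, ?_⟩, ?_⟩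
    · change S (y - T z) = 0
      rw [map_sub, hz', sub_self]
    · rw [LinearMap.comp_apply, ← sub_eq_zero, ← map_sub, relQuot_mkQ_eq_zero_iff]
      change P (y - T z) - y ∈ LinearMap.range (calT S T).toLinearMap
      rw [map_sub, hP, Submodule.orthogonalProjectionOnto_mem_subspace_eq_self,
        ← calT_orthogonalProjection, sub_sub_cancel_left]
      exact neg_mem ⟨_, rfl⟩
  · intro x
    rw [LinearMap.comp_apply, relQuot_mkQ_eq_zero_iff]
    constructor
    · rintro ⟨z, hz⟩
      have hz' : P (x - T z) = 0 := by
        rw [map_sub, sub_eq_zero]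
        exact hz.symm
      obtain ⟨u, hu⟩ := (orthogonalProjection_orthogonal_eq_zero_iff _ _).1 hz'
      have hu' : T (S u) = x - T z := hu
      exact ⟨S u + z, by simp [hu']⟩
    · rintro ⟨z, hz⟩
      change P (x : H₁) ∈ LinearMap.range (calT S T).toLinearMap
      rw [← hz]
      exact ⟨_, calT_orthogonalProjection S T z⟩

end Compression

theorem fredholm_pair_compression (S : H₁ →L[ℂ] H₂) (T : H₂ →L[ℂ] H₁)
    (hTS : FiniteDimensional ℂ (LinearMap.range (T ∘L S).toLinearMap))
    (hST : FiniteDimensional ℂ (LinearMap.range (S ∘L T).toLinearMap)) :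
    (calS S T ∘L calT S T = 0 ∧ calT S T ∘L calS S T = 0) ∧
    (IsFredholmPair S T ↔ IsFredholmPair (calS S T) (calT S T)) ∧
    (IsFredholmPair S T →
      pairIndex S T = pairIndex (calS S T) (calT S T)
        - (finrank ℂ (LinearMap.range (S ∘L T).toLinearMap) : ℤ)
        + (finrank ℂ (LinearMap.range (T ∘L S).toLinearMap) : ℤ)) := by
  have h₁ : calS S T ∘L calT S T = 0 := calS_comp_calT S T
  have h₂ : calT S T ∘L calS S T = 0 := calS_comp_calT T S
  obtain ⟨e₁⟩ := nonempty_relQuot_ker_range_equiv S T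
  obtain ⟨e₂⟩ : Nonempty (relQuot (LinearMap.ker T.toLinearMap) (LinearMap.range S.toLinearMap)
      ≃ₗ[ℂ] relQuot (LinearMap.ker (calT S T).toLinearMap)
        (LinearMap.range (calS S T).toLinearMap)) := nonempty_relQuot_ker_range_equiv T S
  obtain ⟨e₃⟩ := nonempty_relQuot_range_ker_equiv S T
  obtain ⟨e₄⟩ := nonempty_relQuot_range_ker_equiv T S
  obtain ⟨e₅⟩ := nonempty_relQuot_range_ker_equiv (calS S T) (calT S T)
  obtain ⟨e₆⟩ := nonempty_relQuot_range_ker_equiv (calT S T) (calS S T)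
  have f₃ := e₃.symm.finiteDimensional
  have f₄ := e₄.symm.finiteDimensional
  rw [h₁, toLinearMap_zero, LinearMap.range_zero] at e₅
  rw [h₂, toLinearMap_zero, LinearMap.range_zero] at e₆
  have f₅ := e₅.symm.finiteDimensional
  have f₆ := e₆.symm.finiteDimensional
  refine ⟨⟨h₁, h₂⟩, ⟨?_, ?_⟩, fun _ => ?_⟩
  · rintro ⟨i₁, -, i₂, -⟩
    exact ⟨e₁.finiteDimensional, f₅, e₂.finiteDimensional, f₆⟩
  · rintro ⟨i₁, -, i₂, -⟩
    exact ⟨e₁.symm.finiteDimensional, f₃, e₂.symm.finiteDimensional, f₄⟩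
  · rw [pairIndex, pairIndex, e₁.finrank_eq, e₂.finrank_eq, e₃.finrank_eq, e₄.finrank_eq,
      e₅.finrank_eq, e₆.finrank_eq, finrank_bot, finrank_bot]
    ring
end
end

section
/- Let H₁ and H₂ be Hilbert spaces and let S ∈ L(H₁,H₂) and T ∈ L(H₂,H₁) be such that R(TS) and R(ST) are finite-dimensional subspaces of H₁ and H₂ respectively. Then (S,T) is a Fredholm pair if and only if TT* + S*S ∈ L(H₁) and SS* + T*T ∈ L(H₂) are Fredholm operators. -/
open Module ContinuousLinearMap

noncomputable section

set_option maxHeartbeats 1000000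
set_option synthInstance.maxHeartbeats 1000000

variable {H₁ H₂ : Type*} [NormedAddCommGroup H₁] [InnerProductSpace ℂ H₁] [CompleteSpace H₁]
  [NormedAddCommGroup H₂] [InnerProductSpace ℂ H₂] [CompleteSpace H₂]

theorem exists_fg_le_inf_sup {E : Type*} [AddCommGroup E] [Module ℂ E]
    {p q : Submodule ℂ E} (h : FiniteDimensional ℂ (relQuot p q)) :
    ∃ F : Submodule ℂ E, F.FG ∧ p ≤ p ⊓ q ⊔ F := by
  obtain ⟨G, hG⟩ := Submodule.exists_isCompl ((p ⊓ q).comap p.subtype)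
  refine ⟨G.map p.subtype, (Submodule.CoFG.fg_of_isCompl hG h).map _, fun x hx ↦ ?_⟩
  have hxG : (⟨x, hx⟩ : p) ∈ (p ⊓ q).comap p.subtype ⊔ G := hG.sup_eq_top ▸ Submodule.mem_top
  obtain ⟨y, hy, z, hz, hyz⟩ := Submodule.mem_sup.1 hxG
  exact Submodule.mem_sup.2 ⟨y, hy, z, Submodule.mem_map_of_mem hz, congrArg Subtype.val hyz⟩

theorem finiteDimensional_relQuot_iff {E : Type*} [AddCommGroup E] [Module ℂ E]
    {p q : Submodule ℂ E} :
    FiniteDimensional ℂ (relQuot p q) ↔ ∃ F : Submodule ℂ E, F.FG ∧ p ≤ q ⊔ F := by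
  constructor
  · intro h
    obtain ⟨F, hF, hle⟩ := exists_fg_le_inf_sup h
    exact ⟨F, hF, hle.trans (sup_le_sup_right inf_le_right F)⟩
  · rintro ⟨F, hF, hle⟩
    have hker : (p ⊓ q).comap p.subtype = LinearMap.ker (q.mkQ ∘ₗ p.subtype) := by
      ext x
      simp
    change Submodule.CoFG _
    rw [hker, ← Submodule.range_fg_iff_ker_cofg]
    have hFG : (F.map q.mkQ).FG := hF.map _
    refine Submodule.FG.of_le hFG ?_
    rintro _ ⟨x, rfl⟩
    obtain ⟨y, hy, z, hz, hyz⟩ := Submodule.mem_sup.1 (hle x.2)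
    refine ⟨z, hz, ?_⟩
    simp [← hyz, (Submodule.Quotient.mk_eq_zero q).2 hy]

theorem finiteDimensional_relQuot_range_ker {E F G : Type*} [AddCommGroup E] [Module ℂ E]
    [AddCommGroup F] [Module ℂ F] [AddCommGroup G] [Module ℂ G] (f : E →ₗ[ℂ] F) (g : F →ₗ[ℂ] G)
    (h : FiniteDimensional ℂ (LinearMap.range (g ∘ₗ f))) :
    FiniteDimensional ℂ (relQuot (LinearMap.range f) (LinearMap.ker g)) := by
  have hker : (LinearMap.range f ⊓ LinearMap.ker g).comap (LinearMap.range f).subtype =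
      LinearMap.ker (g ∘ₗ (LinearMap.range f).subtype) := by
    ext x
    simp
  change Submodule.CoFG _
  rw [hker, ← Submodule.range_fg_iff_ker_cofg, LinearMap.range_comp, Submodule.range_subtype,
    ← LinearMap.range_comp]
  exact Module.Finite.iff_fg.1 h

theorem range_domRestrict_orthogonal_ker {E F : Type*} [NormedAddCommGroup E]
    [InnerProductSpace ℂ E] [CompleteSpace E] [NormedAddCommGroup F] [InnerProductSpace ℂ F]
    (f : E →L[ℂ] F) :
    LinearMap.range (f.domRestrict (LinearMap.ker f.toLinearMap)ᗮ).toLinearMap =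
      LinearMap.range f.toLinearMap := by
  have : CompleteSpace (LinearMap.ker f.toLinearMap) := f.isClosed_ker.completeSpace_coe
  apply le_antisymm
  · rintro _ ⟨x, rfl⟩
    exact ⟨x, rfl⟩
  · rintro _ ⟨x, rfl⟩
    obtain ⟨y, hy, z, hz, rfl⟩ :=
      (LinearMap.ker f.toLinearMap).exists_add_mem_mem_orthogonal x
    refine ⟨⟨z, hz⟩, ?_⟩
    have : f y = 0 := hy
    simp [this]

theorem ker_domRestrict_orthogonal_ker {E F : Type*} [NormedAddCommGroup E]
    [InnerProductSpace ℂ E] [NormedAddCommGroup F] [InnerProductSpace ℂ F]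
    (f : E →L[ℂ] F) :
    LinearMap.ker (f.domRestrict (LinearMap.ker f.toLinearMap)ᗮ).toLinearMap = ⊥ := by
  rw [LinearMap.ker_eq_bot']
  intro x hx
  have h := (LinearMap.ker f.toLinearMap).inf_orthogonal_eq_bot
  exact Subtype.ext ((Submodule.mem_bot ℂ).1 (h ▸ ⟨hx, x.2⟩))

theorem isClosed_range_of_isClosed_sup (f : H₁ →L[ℂ] H₂) {F : Submodule ℂ H₂} (hF : F.FG)
    (hclosed : IsClosed ((LinearMap.range f.toLinearMap ⊔ F : Submodule ℂ H₂) : Set H₂)) :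
    IsClosed (LinearMap.range f.toLinearMap : Set H₂) := by
  set K := LinearMap.range f.toLinearMap ⊔ F
  have : CompleteSpace K := hclosed.completeSpace_coe
  let g : (LinearMap.ker f.toLinearMap)ᗮ →L[ℂ] K :=
    (f.domRestrict (LinearMap.ker f.toLinearMap)ᗮ).codRestrict K
      fun x ↦ Submodule.mem_sup_left ⟨x, rfl⟩
  have hgker : LinearMap.ker g.toLinearMap = ⊥ := by
    rw [← ker_domRestrict_orthogonal_ker f]
    exact ker_codRestrict _ _ _
  have hgmap : (LinearMap.range g.toLinearMap).map K.subtype = LinearMap.range f.toLinearMap := by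
    rw [← range_domRestrict_orthogonal_ker f, ← LinearMap.range_comp]
    rfl
  have hFK : (F.comap K.subtype).FG := by
    have : FiniteDimensional ℂ F := Module.Finite.iff_fg.2 hF
    have : FiniteDimensional ℂ (F.comap K.subtype) :=
      (Submodule.comapSubtypeEquivOfLe (le_sup_right : F ≤ K)).symm.finiteDimensional
    exact Module.Finite.iff_fg.1 this
  have hcod : Codisjoint (F.comap K.subtype) (LinearMap.range g.toLinearMap) := by
    rw [codisjoint_iff, eq_top_iff]
    rintro ⟨x, hx⟩ -
    obtain ⟨y, hy, z, hz, hyz⟩ := Submodule.mem_sup.1 hx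
    rw [← hgmap] at hy
    obtain ⟨y, hy, rfl⟩ := hy
    rw [sup_comm]
    exact Submodule.mem_sup.2 ⟨y, hy, ⟨z, Submodule.mem_sup_right hz⟩, hz, Subtype.ext hyz⟩
  obtain ⟨G, hG⟩ := Submodule.exists_isCompl (LinearMap.range g.toLinearMap)
  have : FiniteDimensional ℂ G :=
    Module.Finite.iff_fg.2 (Submodule.CoFG.fg_of_isCompl hG (hFK.cofg_of_codisjoint hcod))
  have hg := closed_complemented_range_of_isCompl_of_ker_eq_bot g G hG
    G.closed_of_finiteDimensional hgker
  rw [← hgmap]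
  exact hclosed.isClosedEmbedding_subtypeVal.isClosedMap _ hg

theorem orthogonal_ker_le_range_adjoint (f : H₁ →L[ℂ] H₂)
    (hf : IsClosed (LinearMap.range f.toLinearMap : Set H₂)) :
    (LinearMap.ker f.toLinearMap)ᗮ ≤ LinearMap.range (adjoint f).toLinearMap := by
  have : CompleteSpace (LinearMap.ker f.toLinearMap) := f.isClosed_ker.completeSpace_coe
  let g := f.domRestrict (LinearMap.ker f.toLinearMap)ᗮ
  have hgrange : IsClosed (Set.range g) := by
    rw [← range_domRestrict_orthogonal_ker f] at hf
    exact hf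
  obtain ⟨K, hK⟩ := g.antilipschitz_of_injective_of_isClosed_range
    (LinearMap.ker_eq_bot.1 (ker_domRestrict_orthogonal_ker f)) hgrange
  have hbound (x) : ‖x‖ ≤ (K + 1) * ‖g x‖ := by
    have := hK.le_mul_norm_sub x 0
    rw [map_zero, add_zero, add_zero, norm_neg, norm_neg] at this
    nlinarith [norm_nonneg (g x)]
  have hunit : IsUnit (adjoint g ∘L g) := by
    refine isUnit_of_forall_le_norm_inner_map _ (c := ((K + 1) ^ 2)⁻¹) (by positivity) fun x ↦ ?_
    have hinner : ‖inner ℂ ((adjoint g ∘L g) x) x‖ = ‖g x‖ ^ 2 := by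
      rw [comp_apply, adjoint_inner_left, inner_self_eq_norm_sq_to_K]
      simp
    rw [hinner]
    push_cast
    rw [← div_eq_mul_inv, div_le_iff₀ (by positivity), mul_comm, ← mul_pow]
    gcongr
    exact hbound x
  intro y hy
  obtain ⟨w, hw⟩ := (isUnit_iff_bijective.1 hunit).2 ⟨y, hy⟩
  refine ⟨g w, ext_inner_right ℂ fun x ↦ ?_⟩
  obtain ⟨u, hu, v, hv, rfl⟩ := (LinearMap.ker f.toLinearMap).exists_add_mem_mem_orthogonal x
  have hfu : f u = 0 := hu
  have hyu : inner ℂ y u = 0 := (Submodule.mem_orthogonal' _ _).1 hy u hu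
  have hyv : inner ℂ (adjoint g (g w)) ⟨v, hv⟩ = inner ℂ y v := by
    rw [← comp_apply, hw]
    rfl
  rw [adjoint_inner_left] at hyv
  rw [coe_coe, adjoint_inner_left, map_add, hfu, zero_add, inner_add_right, hyu, zero_add, ← hyv]
  rfl

theorem isFredholmOp_of_isSelfAdjoint {A : H₁ →L[ℂ] H₁} (hA : IsSelfAdjoint A)
    {F : Submodule ℂ H₁} (hF : F.FG) (htop : LinearMap.range A.toLinearMap ⊔ F = ⊤) :
    IsFredholmOp A := by
  have hcofg : (LinearMap.range A.toLinearMap).CoFG :=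
    hF.cofg_of_codisjoint (codisjoint_iff.2 (sup_comm F _ ▸ htop))
  refine ⟨?_, isClosed_range_of_isClosed_sup A hF (by simp [htop]), hcofg⟩
  rw [← hA.isStarNormal.orthogonal_range]
  exact Module.Finite.iff_fg.2
    (hcofg.fg_of_disjoint (LinearMap.range A.toLinearMap).orthogonal_disjoint.symm)

theorem surjective_of_sup_range_eq_top (S : H₁ →L[ℂ] H₂) (T : H₂ →L[ℂ] H₁)
    (F : Submodule ℂ H₁) [FiniteDimensional ℂ F]
    (htop : LinearMap.range T.toLinearMap ⊔ LinearMap.range (adjoint S).toLinearMap ⊔ F = ⊤) :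
    Function.Surjective ((T ∘L adjoint T) + (adjoint S ∘L S) + F.starProjection) := by
  let D : (H₂ × H₂) × F →L[ℂ] H₁ := (T.coprod (adjoint S)).coprod F.subtypeL
  have hD : Function.Surjective D := by
    intro x
    have hx : x ∈ LinearMap.range T.toLinearMap ⊔ LinearMap.range (adjoint S).toLinearMap ⊔ F := by
      simp [htop]
    obtain ⟨_, hy, z, hz, rfl⟩ := Submodule.mem_sup.1 hx
    obtain ⟨_, ⟨a, rfl⟩, _, ⟨b, rfl⟩, rfl⟩ := Submodule.mem_sup.1 hy
    exact ⟨((a, b), ⟨z, hz⟩), by simp [D]⟩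
  obtain ⟨C, hC, hpre⟩ := D.exists_preimage_norm_le hD
  lift C to NNReal using hC.le
  have hC' : 0 < C := hC
  refine (isUnit_iff_bijective.1 (isUnit_of_forall_le_norm_inner_map _ (c := (3 * C ^ 2)⁻¹)
    (by positivity) fun x ↦ ?_)).2
  have hinner : ‖inner ℂ (((T ∘L adjoint T) + (adjoint S ∘L S) + F.starProjection) x) x‖ =
      ‖adjoint T x‖ ^ 2 + ‖S x‖ ^ 2 + ‖F.starProjection x‖ ^ 2 := by
    have hP : inner ℂ (F.starProjection x) x = (‖F.starProjection x‖ : ℂ) ^ 2 := by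
      rw [← F.starProjection_eq_self_iff.2 (F.starProjection_apply_mem x),
        Submodule.inner_starProjection_left_eq_right,
        F.starProjection_eq_self_iff.2 (F.starProjection_apply_mem x)]
      exact inner_self_eq_norm_sq_to_K _
    have hT : inner ℂ (T (adjoint T x)) x = (‖adjoint T x‖ : ℂ) ^ 2 := by
      rw [← adjoint_inner_right]
      exact inner_self_eq_norm_sq_to_K _
    have hS : inner ℂ (adjoint S (S x)) x = (‖S x‖ : ℂ) ^ 2 := by
      rw [adjoint_inner_left]
      exact inner_self_eq_norm_sq_to_K _
    simp only [add_apply, comp_apply, inner_add_left, hP, hT, hS]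
    norm_cast
    rw [Real.norm_of_nonneg (by positivity)]
  have hx : ‖x‖ ≤ C * (‖adjoint T x‖ + ‖S x‖ + ‖F.starProjection x‖) := by
    obtain ⟨⟨⟨a, b⟩, m⟩, hDx, hle⟩ := hpre x
    have ha : ‖a‖ ≤ C * ‖x‖ := ((_root_.norm_fst_le _).trans (_root_.norm_fst_le _)).trans hle
    have hb : ‖b‖ ≤ C * ‖x‖ := ((_root_.norm_snd_le _).trans (_root_.norm_fst_le _)).trans hle
    have hm : ‖m‖ ≤ C * ‖x‖ := (_root_.norm_snd_le _).trans hle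
    have hDx' : T a + adjoint S b + m = x := hDx
    have hinnerx : inner ℂ x x = inner ℂ (adjoint T x) a + inner ℂ (S x) b +
        inner ℂ (F.starProjection x) (m : H₁) := by
      conv_lhs => rw [← hDx']
      conv_lhs => rw [inner_add_right, inner_add_right, hDx']
      rw [adjoint_inner_left, adjoint_inner_right, Submodule.inner_starProjection_left_eq_right,
        Submodule.starProjection_eq_self_iff.2 m.2]
    have hsq : ‖x‖ * ‖x‖ ≤ ‖x‖ * (C * (‖adjoint T x‖ + ‖S x‖ + ‖F.starProjection x‖)) :=
      calc ‖x‖ * ‖x‖ = ‖inner ℂ x x‖ := by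
            rw [inner_self_eq_norm_sq_to_K]
            simp [sq]
        _ ≤ ‖adjoint T x‖ * ‖a‖ + ‖S x‖ * ‖b‖ + ‖F.starProjection x‖ * ‖m‖ := by
            rw [hinnerx]
            refine (norm_add₃_le).trans ?_
            gcongr
            all_goals exact norm_inner_le_norm _ _
        _ ≤ ‖adjoint T x‖ * (C * ‖x‖) + ‖S x‖ * (C * ‖x‖) + ‖F.starProjection x‖ * (C * ‖x‖) := by
            gcongr
        _ = _ := by ring
    rcases (norm_nonneg x).eq_or_lt with h0 | h0
    · rw [← h0]
      positivity
    · exact le_of_mul_le_mul_left hsq h0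
  rw [hinner]
  push_cast
  rw [← div_eq_mul_inv, div_le_iff₀ (by positivity)]
  calc ‖x‖ ^ 2 ≤ (C * (‖adjoint T x‖ + ‖S x‖ + ‖F.starProjection x‖)) ^ 2 := by gcongr
    _ = (‖adjoint T x‖ + ‖S x‖ + ‖F.starProjection x‖) ^ 2 * C ^ 2 := by ring
    _ ≤ (3 * (‖adjoint T x‖ ^ 2 + ‖S x‖ ^ 2 + ‖F.starProjection x‖ ^ 2)) * C ^ 2 := by
        gcongr
        nlinarith [sq_nonneg (‖adjoint T x‖ - ‖S x‖), sq_nonneg (‖S x‖ - ‖F.starProjection x‖),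
          sq_nonneg (‖adjoint T x‖ - ‖F.starProjection x‖)]
    _ = _ := by ring

theorem isFredholmOp_add_of_sup_range_eq_top (S : H₁ →L[ℂ] H₂) (T : H₂ →L[ℂ] H₁)
    {F : Submodule ℂ H₁} (hF : F.FG)
    (htop : LinearMap.range T.toLinearMap ⊔ LinearMap.range (adjoint S).toLinearMap ⊔ F = ⊤) :
    IsFredholmOp ((T ∘L adjoint T) + (adjoint S ∘L S)) := by
  have : FiniteDimensional ℂ F := Module.Finite.iff_fg.2 hF
  refine isFredholmOp_of_isSelfAdjoint ?_ hF ?_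
  · simp [IsSelfAdjoint, star_eq_adjoint, adjoint_comp]
  · rw [eq_top_iff]
    intro y _
    obtain ⟨x, rfl⟩ := surjective_of_sup_range_eq_top S T F htop y
    exact Submodule.add_mem_sup ⟨x, rfl⟩ (F.starProjection_apply_mem x)

theorem isClosed_range_of_finiteDimensional_relQuot (S : H₁ →L[ℂ] H₂) (T : H₂ →L[ℂ] H₁)
    (hTS : FiniteDimensional ℂ (LinearMap.range (T ∘L S).toLinearMap))
    (h : FiniteDimensional ℂ
      (relQuot (LinearMap.ker T.toLinearMap) (LinearMap.range S.toLinearMap))) :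
    IsClosed (LinearMap.range S.toLinearMap : Set H₂) := by
  obtain ⟨F, hF, hle⟩ := finiteDimensional_relQuot_iff.1 h
  obtain ⟨G, hG, hle'⟩ := finiteDimensional_relQuot_iff.1
    (finiteDimensional_relQuot_range_ker S.toLinearMap T.toLinearMap hTS)
  refine isClosed_range_of_isClosed_sup S (hF.sup hG) ?_
  have heq : LinearMap.range S.toLinearMap ⊔ (F ⊔ G) = LinearMap.ker T.toLinearMap ⊔ (F ⊔ G) := by
    apply le_antisymm
    · exact sup_le (hle'.trans (sup_le_sup_left le_sup_right _)) le_sup_right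
    · exact sup_le (hle.trans (sup_le_sup_left le_sup_left _)) le_sup_right
  have : FiniteDimensional ℂ ↥(F ⊔ G) := Module.Finite.iff_fg.2 (hF.sup hG)
  rw [heq]
  exact Submodule.isClosed_sup_finiteDimensional _ _ T.isClosed_ker

theorem isFredholmOp_add_of_finiteDimensional_relQuot (S : H₁ →L[ℂ] H₂) (T : H₂ →L[ℂ] H₁)
    (hS : IsClosed (LinearMap.range S.toLinearMap : Set H₂))
    (h : FiniteDimensional ℂ
      (relQuot (LinearMap.ker S.toLinearMap) (LinearMap.range T.toLinearMap))) :
    IsFredholmOp ((T ∘L adjoint T) + (adjoint S ∘L S)) := by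
  have : CompleteSpace (LinearMap.ker S.toLinearMap) := S.isClosed_ker.completeSpace_coe
  obtain ⟨F, hF, hle⟩ := finiteDimensional_relQuot_iff.1 h
  refine isFredholmOp_add_of_sup_range_eq_top S T hF (eq_top_iff.2 ?_)
  rw [← Submodule.sup_orthogonal_of_hasOrthogonalProjection (K := LinearMap.ker S.toLinearMap)]
  refine sup_le (hle.trans (sup_le_sup_right le_sup_left _)) ?_
  exact (orthogonal_ker_le_range_adjoint S hS).trans (le_sup_right.trans le_sup_left)

theorem finiteDimensional_relQuot_of_isFredholmOp_add (S : H₁ →L[ℂ] H₂) (T : H₂ →L[ℂ] H₁)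
    (hST : FiniteDimensional ℂ (LinearMap.range (S ∘L T).toLinearMap))
    (h : IsFredholmOp ((T ∘L adjoint T) + (adjoint S ∘L S))) :
    FiniteDimensional ℂ
      (relQuot (LinearMap.ker S.toLinearMap) (LinearMap.range T.toLinearMap)) := by
  set N := LinearMap.ker S.toLinearMap
  have : CompleteSpace N := S.isClosed_ker.completeSpace_coe
  set A := (T ∘L adjoint T) + (adjoint S ∘L S)
  obtain ⟨F, hAF⟩ := Submodule.exists_isCompl (LinearMap.range A.toLinearMap)
  have hF : F.FG := Submodule.CoFG.fg_of_isCompl hAF h.2.2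
  obtain ⟨G, hG, hle⟩ := exists_fg_le_inf_sup
    (finiteDimensional_relQuot_range_ker T.toLinearMap S.toLinearMap hST)
  refine finiteDimensional_relQuot_iff.2
    ⟨(G ⊔ F).map N.starProjection.toLinearMap, (hG.sup hF).map _, fun x hx ↦ ?_⟩
  have hxA : x ∈ LinearMap.range A.toLinearMap ⊔ F := hAF.sup_eq_top ▸ Submodule.mem_top
  obtain ⟨_, ⟨u, rfl⟩, f, hf, hxf⟩ := Submodule.mem_sup.1 hxA
  obtain ⟨t, ht, g, hg, htg⟩ := Submodule.mem_sup.1 (hle ⟨adjoint T u, rfl⟩)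
  rw [coe_coe] at htg
  have hSu : N.starProjection (adjoint S (S u)) = 0 := by
    rw [Submodule.starProjection_apply_eq_zero_iff, Submodule.mem_orthogonal]
    intro n hn
    have hn' : S n = 0 := hn
    rw [adjoint_inner_right, hn', inner_zero_left]
  have hxeq : x = t + N.starProjection (g + f) := by
    have hsum : x = t + g + adjoint S (S u) + f := by
      rw [htg, ← hxf]
      simp [A]
    calc x = N.starProjection x := (Submodule.starProjection_eq_self_iff.2 hx).symm
      _ = _ := by
        rw [hsum, map_add, map_add, map_add, hSu, map_add,
          Submodule.starProjection_eq_self_iff.2 ht.2, add_zero, add_assoc]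
  rw [hxeq]
  exact Submodule.add_mem_sup ht.1 (Submodule.mem_map_of_mem (Submodule.add_mem_sup hg hf))

theorem fredholm_pair_iff_selfadjoint (S : H₁ →L[ℂ] H₂) (T : H₂ →L[ℂ] H₁)
    (hTS : FiniteDimensional ℂ (LinearMap.range (T ∘L S).toLinearMap))
    (hST : FiniteDimensional ℂ (LinearMap.range (S ∘L T).toLinearMap)) :
    IsFredholmPair S T ↔
      IsFredholmOp ((T ∘L adjoint T) + (adjoint S ∘L S)) ∧
        IsFredholmOp ((S ∘L adjoint S) + (adjoint T ∘L T)) := by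
  constructor
  · rintro ⟨hN₁, -, hN₂, -⟩
    exact ⟨isFredholmOp_add_of_finiteDimensional_relQuot S T
        (isClosed_range_of_finiteDimensional_relQuot S T hTS hN₂) hN₁,
      isFredholmOp_add_of_finiteDimensional_relQuot T S
        (isClosed_range_of_finiteDimensional_relQuot T S hST hN₁) hN₂⟩
  · rintro ⟨hA, hB⟩
    exact ⟨finiteDimensional_relQuot_of_isFredholmOp_add S T hST hA,
      finiteDimensional_relQuot_range_ker T.toLinearMap S.toLinearMap hST,
      finiteDimensional_relQuot_of_isFredholmOp_add T S hTS hB,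
      finiteDimensional_relQuot_range_ker S.toLinearMap T.toLinearMap hTS⟩
end
end

section
/- Let H₁ and H₂ be Hilbert spaces and let (S,T) be a Fredholm pair, S ∈ L(H₁,H₂), T ∈ L(H₂,H₁). Then there exists ε > 0 such that for all S₁ ∈ L(H₁,H₂) and T₁ ∈ L(H₂,H₁) with R(T₁S₁) and R(S₁T₁) finite-dimensional, if ‖S − S₁‖ < ε and ‖T − T₁‖ < ε, then (S₁,T₁) is a Fredholm pair and ind(S,T) = ind(S₁,T₁). -/
open Module ContinuousLinearMap

noncomputable section

set_option maxHeartbeats 1000000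
set_option synthInstance.maxHeartbeats 1000000

section RelativeLength

/-- The length of `p / (p ⊓ q)`, i.e. its dimension with values in `ℕ∞`. -/
def relLength {E : Type*} [AddCommGroup E] [Module ℂ E] (p q : Submodule ℂ E) : ℕ∞ :=
  Module.length ℂ (relQuot p q)

lemma length_ne_top_iff_finiteDimensional {V : Type*} [AddCommGroup V] [Module ℂ V] :
    Module.length ℂ V ≠ ⊤ ↔ FiniteDimensional ℂ V := by
  rw [Module.length_ne_top_iff]
  exact (IsSemisimpleModule.finite_tfae (R := ℂ) (M := V)).out 3 0

lemma finrank_eq_toNat_length {V : Type*} [AddCommGroup V] [Module ℂ V] [FiniteDimensional ℂ V] :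
    finrank ℂ V = (Module.length ℂ V).toNat := by
  rw [Module.length_eq_finrank, ENat.toNat_natCast]

lemma length_quotient_eq_add {X Y Z : Type*} [AddCommGroup X] [Module ℂ X] [AddCommGroup Y]
    [Module ℂ Y] [AddCommGroup Z] [Module ℂ Z] (i : X →ₗ[ℂ] Y) (g : Y →ₗ[ℂ] Z)
    (p : Submodule ℂ X) (r : Submodule ℂ Y) (s : Submodule ℂ Z)
    (hi : ∀ x, i x ∈ r ↔ x ∈ p) (hg : ∀ z, ∃ y, z - g y ∈ s)
    (hs : ∀ y, g y ∈ s ↔ ∃ x, y - i x ∈ r) :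
    Module.length ℂ (Y ⧸ r) = Module.length ℂ (X ⧸ p) + Module.length ℂ (Z ⧸ s) := by
  have hrs : r ≤ s.comap g := fun y hy ↦ (hs y).2 ⟨0, by simpa using hy⟩
  refine Module.length_eq_add_of_exact (p.mapQ r i fun x hx ↦ (hi x).2 hx) (r.mapQ s g hrs) ?_ ?_ ?_
  · rw [← LinearMap.ker_eq_bot, LinearMap.ker_eq_bot']
    intro a
    induction a using Submodule.Quotient.induction_on with
    | _ x => simp [Submodule.mapQ_apply, Submodule.Quotient.mk_eq_zero, hi]
  · intro c
    induction c using Submodule.Quotient.induction_on with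
    | _ z =>
      obtain ⟨y, hy⟩ := hg z
      refine ⟨Submodule.Quotient.mk y, ?_⟩
      rw [Submodule.mapQ_apply, eq_comm, Submodule.Quotient.eq]
      exact hy
  · intro b
    induction b using Submodule.Quotient.induction_on with
    | _ y =>
      rw [Submodule.mapQ_apply, Submodule.Quotient.mk_eq_zero, hs]
      constructor
      · rintro ⟨x, hx⟩
        refine ⟨Submodule.Quotient.mk x, ?_⟩
        rw [Submodule.mapQ_apply, eq_comm, Submodule.Quotient.eq]
        exact hx
      · rintro ⟨a, ha⟩
        induction a using Submodule.Quotient.induction_on with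
        | _ x =>
          rw [Submodule.mapQ_apply, eq_comm, Submodule.Quotient.eq] at ha
          exact ⟨x, ha⟩

lemma length_quotient_eq {X Y : Type*} [AddCommGroup X] [Module ℂ X] [AddCommGroup Y]
    [Module ℂ Y] (i : X →ₗ[ℂ] Y) (p : Submodule ℂ X) (r : Submodule ℂ Y)
    (hi : ∀ x, i x ∈ r ↔ x ∈ p) (hr : ∀ y, ∃ x, y - i x ∈ r) :
    Module.length ℂ (Y ⧸ r) = Module.length ℂ (X ⧸ p) := by
  rw [length_quotient_eq_add i (0 : Y →ₗ[ℂ] PUnit) p r ⊤ hi (by simp) (by simpa using hr),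
    Module.length_eq_zero (M := PUnit ⧸ (⊤ : Submodule ℂ PUnit)), add_zero]

variable {E F : Type*} [AddCommGroup E] [Module ℂ E] [AddCommGroup F] [Module ℂ F]

lemma relLength_eq_zero {p q : Submodule ℂ E} (h : p ≤ q) : relLength p q = 0 := by
  rw [relLength, Module.length_eq_zero_iff, Submodule.Quotient.subsingleton_iff]
  rw [eq_top_iff]
  exact fun x _ ↦ ⟨x.2, h x.2⟩

lemma relLength_bot (p : Submodule ℂ E) : relLength p ⊥ = Module.length ℂ p :=
  (Submodule.quotEquivOfEqBot _ (by simp)).length_eq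

lemma relLength_inf_right (p q : Submodule ℂ E) : relLength p (p ⊓ q) = relLength p q := by
  have h : p ⊓ (p ⊓ q) = p ⊓ q := by rw [← inf_assoc, inf_idem]
  unfold relLength relQuot
  rw [h]

lemma relLength_inf_left (p q : Submodule ℂ E) : relLength p (q ⊓ p) = relLength p q := by
  rw [inf_comm, relLength_inf_right]

lemma relLength_tower (p : Submodule ℂ E) {q r : Submodule ℂ E} (h : r ≤ q) :
    relLength p r = relLength (p ⊓ q) r + relLength p q := by
  refine length_quotient_eq_add (Submodule.inclusion inf_le_left) LinearMap.id _ _ _ ?_ ?_ ?_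
  · rintro ⟨x, hx⟩
    exact ⟨fun h ↦ ⟨hx, h.2⟩, fun h ↦ ⟨hx.1, h.2⟩⟩
  · exact fun z ↦ ⟨z, by simp⟩
  · rintro ⟨y, hy⟩
    constructor
    · rintro ⟨-, hyq⟩
      exact ⟨⟨y, hy, hyq⟩, by simp⟩
    · rintro ⟨⟨x, hx⟩, hxy⟩
      refine ⟨hy, ?_⟩
      simpa using q.add_mem (h hxy.2) hx.2

lemma relLength_top_eq (f : E →ₗ[ℂ] F) (K : Submodule ℂ E) :
    relLength ⊤ K = relLength (LinearMap.ker f) K + relLength (LinearMap.range f) (K.map f) := by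
  refine length_quotient_eq_add (Submodule.inclusion le_top)
    (f.rangeRestrict ∘ₗ Submodule.subtype ⊤) _ _ _ ?_ ?_ ?_
  · rintro ⟨x, hx⟩
    simp_all
  · rintro ⟨_, y, rfl⟩
    refine ⟨⟨y, trivial⟩, ?_⟩
    convert Submodule.zero_mem _
    ext
    simp
  · rintro ⟨y, hy⟩
    constructor
    · rintro ⟨-, k, hk, hky⟩
      refine ⟨⟨y - k, ?_⟩, ?_⟩
      · simpa [sub_eq_zero] using hky.symm
      · simpa using hk
    · rintro ⟨⟨x, hx⟩, -, hxy⟩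
      refine ⟨⟨y, rfl⟩, y - x, hxy, ?_⟩
      have hx : f x = 0 := hx
      simp [hx]

/-- Two subspaces are commensurable if their intersection has finite codimension in both. -/
def Commens (p q : Submodule ℂ E) : Prop := relLength p q ≠ ⊤ ∧ relLength q p ≠ ⊤

/-- The relative dimension `dim p / (p ⊓ q) - dim q / (p ⊓ q)`. -/
def relIndex (p q : Submodule ℂ E) : ℤ := (relLength p q).toNat - (relLength q p).toNat

lemma commens_comm {p q : Submodule ℂ E} : Commens p q ↔ Commens q p := and_comm

lemma relIndex_swap (p q : Submodule ℂ E) : relIndex p q = - relIndex q p := by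
  simp [relIndex]

lemma commens_iff_and_relIndex {p p' : Submodule ℂ E} (hle : p' ≤ p) (hfin : relLength p p' ≠ ⊤)
    (q : Submodule ℂ E) :
    (Commens p q ↔ Commens p' q) ∧
      (Commens p q → relIndex p q = relIndex p' q + (relLength p p').toNat) := by
  have h₁ := relLength_tower p (inf_le_left : p' ⊓ q ≤ p')
  have h₂ := relLength_tower p (inf_le_right : p' ⊓ q ≤ q)
  have h₃ := relLength_tower q (inf_le_left.trans hle : p' ⊓ q ≤ p)
  rw [inf_eq_right.2 hle, relLength_inf_right] at h₁
  rw [relLength_inf_left, inf_comm q p] at h₃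
  have h₄ : relLength (p ⊓ q) (p' ⊓ q) ≠ ⊤ := by
    have e : relLength (p ⊓ q) (p' ⊓ q) = relLength (p ⊓ q) p' := by
      rw [← relLength_inf_right, ← relLength_inf_right _ p']
      congr 1
      ext x
      simp only [Submodule.mem_inf]
      tauto
    rw [e]
    refine ne_top_of_le_ne_top hfin ?_
    refine Module.length_le_of_injective
      (Submodule.mapQ _ _ (Submodule.inclusion inf_le_left) ?_) ?_
    · rintro ⟨x, hx⟩ h
      exact ⟨hx.1, h.2⟩
    · rw [← LinearMap.ker_eq_bot, LinearMap.ker_eq_bot']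
      intro a
      induction a using Submodule.Quotient.induction_on with
      | _ x =>
        rw [Submodule.mapQ_apply, Submodule.Quotient.mk_eq_zero, Submodule.Quotient.mk_eq_zero]
        exact fun h ↦ ⟨x.2, h.2⟩
  rw [h₁] at h₂
  unfold Commens relIndex
  generalize relLength p p' = a at *
  generalize relLength (p ⊓ q) (p' ⊓ q) = e at *
  generalize relLength p q = u at *
  generalize relLength q p = v at *
  generalize relLength p' q = u' at *
  generalize relLength q p' = v' at *
  subst h₃
  lift a to ℕ using hfin
  lift e to ℕ using h₄
  induction u using ENat.recTopCoe <;> induction v using ENat.recTopCoe <;>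
    induction u' using ENat.recTopCoe <;> simp_all <;> norm_cast at *
  simp_all
  rw [← Nat.cast_add, ENat.toNat_natCast]
  grind

end RelativeLength

section Pairs

variable {H₁ H₂ : Type*} [NormedAddCommGroup H₁] [NormedSpace ℂ H₁]
  [NormedAddCommGroup H₂] [NormedSpace ℂ H₂]

lemma isFredholmPair_iff_commens {S : H₁ →L[ℂ] H₂} {T : H₂ →L[ℂ] H₁} :
    IsFredholmPair S T ↔ Commens S.ker T.range ∧ Commens T.ker S.range := by
  simp only [IsFredholmPair, Commens, relLength, length_ne_top_iff_finiteDimensional, and_assoc]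

lemma IsFredholmPair.pairIndex_eq {S : H₁ →L[ℂ] H₂} {T : H₂ →L[ℂ] H₁} (h : IsFredholmPair S T) :
    pairIndex S T = relIndex S.ker T.range - relIndex T.ker S.range := by
  obtain ⟨h₁, h₂, h₃, h₄⟩ := h
  simp only [pairIndex, relIndex, relLength, finrank_eq_toNat_length]
  ring

lemma IsFredholmPair.symm {S : H₁ →L[ℂ] H₂} {T : H₂ →L[ℂ] H₁} (h : IsFredholmPair S T) :
    IsFredholmPair T S := by
  rw [isFredholmPair_iff_commens] at h ⊢
  exact h.symm

lemma pairIndex_swap (S : H₁ →L[ℂ] H₂) (T : H₂ →L[ℂ] H₁) :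
    pairIndex T S = - pairIndex S T := by
  simp only [pairIndex]
  ring

lemma isFredholmPair_iff_of_finiteDimensional_quotient (S : H₁ →L[ℂ] H₂) (T : H₂ →L[ℂ] H₁)
    {K : Submodule ℂ H₁} (hK : relLength ⊤ K ≠ ⊤) :
    (IsFredholmPair S T ↔
      Commens (S.ker ⊓ K) T.range ∧ Commens T.ker (K.map S.toLinearMap)) ∧
    (IsFredholmPair S T → pairIndex S T = relIndex (S.ker ⊓ K) T.range -
      relIndex T.ker (K.map S.toLinearMap) + (relLength ⊤ K).toNat) := by
  have hsum := relLength_top_eq S.toLinearMap K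
  have hne : relLength S.ker K ≠ ⊤ ∧ relLength S.range (K.map S.toLinearMap) ≠ ⊤ := by
    rw [hsum] at hK
    simpa using hK
  obtain ⟨hc₁, hi₁⟩ := commens_iff_and_relIndex (inf_le_left : S.ker ⊓ K ≤ S.ker)
    (by rw [relLength_inf_right]; exact hne.1) T.range
  obtain ⟨hc₂, hi₂⟩ := commens_iff_and_relIndex
    (LinearMap.map_le_range : K.map S.toLinearMap ≤ S.range) hne.2 T.ker
  rw [commens_comm, commens_comm (p := K.map _)] at hc₂
  refine ⟨by rw [isFredholmPair_iff_commens, hc₁, hc₂], fun h ↦ ?_⟩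
  have h' := isFredholmPair_iff_commens.1 h
  rw [h.pairIndex_eq, hi₁ h'.1, relIndex_swap T.ker, relIndex_swap T.ker,
    hi₂ (commens_comm.1 h'.2), hsum, ENat.toNat_add hne.1 hne.2, relLength_inf_right]
  push_cast
  ring

lemma IsFredholmPair.of_finiteDimensional_range_sub_left {S S' : H₁ →L[ℂ] H₂}
    {T : H₂ →L[ℂ] H₁} (hS : FiniteDimensional ℂ (S - S').range) (h : IsFredholmPair S T) :
    IsFredholmPair S' T ∧ pairIndex S T = pairIndex S' T := by
  set K := (S - S').ker with hKdef
  have heq : ∀ x ∈ K, S x = S' x := fun x hx ↦ by simpa [hKdef, sub_eq_zero] using hx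
  have hK : relLength ⊤ K ≠ ⊤ := by
    rw [relLength_top_eq (S - S').toLinearMap K, relLength_eq_zero le_rfl, zero_add]
    exact length_ne_top_iff_finiteDimensional.2 inferInstance
  have hker : S.ker ⊓ K = S'.ker ⊓ K := by
    ext x
    simp +contextual [heq]
  have hmap : K.map S.toLinearMap = K.map S'.toLinearMap := by
    ext y
    exact exists_congr fun x ↦ and_congr_right fun hx ↦ by simp [heq x hx]
  obtain ⟨hf, hi⟩ := isFredholmPair_iff_of_finiteDimensional_quotient S T hK
  obtain ⟨hf', hi'⟩ := isFredholmPair_iff_of_finiteDimensional_quotient S' T hK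
  rw [hker, hmap] at hf hi
  have h' := hf'.2 (hf.1 h)
  exact ⟨h', by rw [hi h, hi' h']⟩

lemma IsFredholmPair.of_finiteDimensional_range_sub {S S' : H₁ →L[ℂ] H₂}
    {T T' : H₂ →L[ℂ] H₁} (hS : FiniteDimensional ℂ (S - S').range)
    (hT : FiniteDimensional ℂ (T - T').range) (h : IsFredholmPair S T) :
    IsFredholmPair S' T' ∧ pairIndex S T = pairIndex S' T' := by
  obtain ⟨h₁, e₁⟩ := h.of_finiteDimensional_range_sub_left hS
  obtain ⟨h₂, e₂⟩ := h₁.symm.of_finiteDimensional_range_sub_left hT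
  refine ⟨h₂.symm, ?_⟩
  rw [e₁, ← neg_inj, ← pairIndex_swap, e₂, pairIndex_swap]

lemma finiteDimensional_range_comp_of_relLength {S : H₁ →L[ℂ] H₂} {T : H₂ →L[ℂ] H₁}
    (h : relLength T.range S.ker ≠ ⊤) : FiniteDimensional ℂ (S ∘L T).range := by
  rw [relLength, length_ne_top_iff_finiteDimensional] at h
  have hker : T.range ⊓ S.ker ≤ LinearMap.ker S.toLinearMap := inf_le_right
  let f : relQuot T.range S.ker →ₗ[ℂ] H₂ :=
    Submodule.liftQ _ (S.toLinearMap ∘ₗ T.range.subtype) fun x hx ↦ hker hx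
  refine Submodule.finiteDimensional_of_le (S₂ := LinearMap.range f) ?_
  rintro _ ⟨x, rfl⟩
  exact ⟨Submodule.Quotient.mk ⟨T x, x, rfl⟩, rfl⟩

end Pairs

section FiniteRank

variable {E F G : Type*} [AddCommGroup E] [Module ℂ E] [AddCommGroup F] [Module ℂ F]
  [AddCommGroup G] [Module ℂ G]

lemma finiteDimensional_range_of_ker_le {f : E →ₗ[ℂ] F} {g : E →ₗ[ℂ] G}
    (hf : FiniteDimensional ℂ (LinearMap.range f)) (h : LinearMap.ker f ≤ LinearMap.ker g) :
    FiniteDimensional ℂ (LinearMap.range g) := by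
  have : FiniteDimensional ℂ (E ⧸ LinearMap.ker f) :=
    f.quotKerEquivRange.symm.finiteDimensional
  refine Submodule.finiteDimensional_of_le (S₂ := LinearMap.range ((LinearMap.ker f).liftQ g h)) ?_
  rintro _ ⟨x, rfl⟩
  exact ⟨Submodule.Quotient.mk x, rfl⟩

lemma finiteDimensional_range_sub {f g : E →ₗ[ℂ] F}
    (hf : FiniteDimensional ℂ (LinearMap.range f)) (hg : FiniteDimensional ℂ (LinearMap.range g)) :
    FiniteDimensional ℂ (LinearMap.range (f - g)) := by
  refine Submodule.finiteDimensional_of_le (S₂ := LinearMap.range f ⊔ LinearMap.range g) ?_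
  rintro _ ⟨x, rfl⟩
  exact Submodule.sub_mem _ (Submodule.mem_sup_left ⟨x, rfl⟩) (Submodule.mem_sup_right ⟨x, rfl⟩)

lemma finiteDimensional_range_add {f g : E →ₗ[ℂ] F}
    (hf : FiniteDimensional ℂ (LinearMap.range f)) (hg : FiniteDimensional ℂ (LinearMap.range g)) :
    FiniteDimensional ℂ (LinearMap.range (f + g)) := by
  refine Submodule.finiteDimensional_of_le (S₂ := LinearMap.range f ⊔ LinearMap.range g) ?_
  rintro _ ⟨x, rfl⟩
  exact Submodule.add_mem _ (Submodule.mem_sup_left ⟨x, rfl⟩) (Submodule.mem_sup_right ⟨x, rfl⟩)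

lemma finiteDimensional_range_of_range_le {f : E →ₗ[ℂ] F} {p : Submodule ℂ F}
    [FiniteDimensional ℂ p] (h : ∀ x, f x ∈ p) : FiniteDimensional ℂ (LinearMap.range f) :=
  Submodule.finiteDimensional_of_le (S₂ := p) (by rintro _ ⟨x, rfl⟩; exact h x)

end FiniteRank

lemma isClosed_range_of_pseudoinverse {H₁ H₂ : Type*} [NormedAddCommGroup H₁] [NormedSpace ℂ H₁]
    [NormedAddCommGroup H₂] [NormedSpace ℂ H₂] {A : H₁ →L[ℂ] H₂} {B : H₂ →L[ℂ] H₁}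
    (h : ∀ x, A (B (A x)) = A x) : IsClosed (A.range : Set H₂) := by
  have : (A.range : Set H₂) = {y | A (B y) = y} := by
    ext y
    constructor
    · rintro ⟨x, rfl⟩
      exact h x
    · exact fun hy ↦ ⟨B y, hy⟩
  rw [this]
  exact isClosed_eq (by fun_prop) continuous_id

section Hilbert

variable {H₁ H₂ : Type*} [NormedAddCommGroup H₁] [InnerProductSpace ℂ H₁] [CompleteSpace H₁]
  [NormedAddCommGroup H₂] [InnerProductSpace ℂ H₂] [CompleteSpace H₂]

lemma finiteDimensional_range_adjoint {A : H₁ →L[ℂ] H₂} (hA : FiniteDimensional ℂ A.range) :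
    FiniteDimensional ℂ (adjoint A).range := by
  have : IsClosed (A.range : Set H₂) := Submodule.closed_of_finiteDimensional _
  let P := A.range.starProjection
  have h : ∀ x, adjoint A x = adjoint A (P x) := fun x ↦ by
    have : x - P x ∈ A.rangeᗮ := A.range.sub_starProjection_mem_orthogonal x
    rw [A.orthogonal_range] at this
    rw [← sub_eq_zero, ← map_sub]
    exact this
  refine finiteDimensional_range_of_range_le (p := A.range.map (adjoint A).toLinearMap) fun x ↦ ?_
  rw [coe_coe, h x]
  exact ⟨P x, A.range.starProjection_apply_mem x, rfl⟩

/-- If both compositions of `S` and `T` have finite rank, then finite rank perturbations of `S`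
and `T` have zero compositions. -/
lemma exists_comp_eq_zero {S : H₁ →L[ℂ] H₂} {T : H₂ →L[ℂ] H₁}
    (hTS : FiniteDimensional ℂ (T ∘L S).range) (hST : FiniteDimensional ℂ (S ∘L T).range) :
    ∃ (S' : H₁ →L[ℂ] H₂) (T' : H₂ →L[ℂ] H₁), FiniteDimensional ℂ (S - S').range ∧
      FiniteDimensional ℂ (T - T').range ∧ (∀ x, S' (T' x) = 0) ∧ ∀ x, T' (S' x) = 0 := by
  let M := (T ∘L S).ker
  have : CompleteSpace M := (T ∘L S).isClosed_ker.completeSpace_coe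
  let S' := S ∘L M.starProjection
  have hS' : FiniteDimensional ℂ (S - S').range := by
    refine finiteDimensional_range_of_ker_le hTS fun x hx ↦ ?_
    have : M.starProjection x = x := Submodule.starProjection_eq_self_iff.2 hx
    simp [S', this]
  have hTS' : ∀ x, T (S' x) = 0 := fun x ↦ M.starProjection_apply_mem x
  have hS'T : FiniteDimensional ℂ (S' ∘L T).range := by
    have h : FiniteDimensional ℂ ((S - S') ∘L T).range :=
      finiteDimensional_range_of_range_le (p := (S - S').range) fun x ↦ ⟨T x, rfl⟩
    have e : S' ∘L T = S ∘L T - (S - S') ∘L T := by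
      ext x
      simp
    rw [e]
    exact finiteDimensional_range_sub hST h
  let L := (S' ∘L T).ker
  have : CompleteSpace L := (S' ∘L T).isClosed_ker.completeSpace_coe
  refine ⟨S', T ∘L L.starProjection, hS', ?_, fun x ↦ L.starProjection_apply_mem x, fun x ↦ ?_⟩
  · refine finiteDimensional_range_of_ker_le hS'T fun x hx ↦ ?_
    have : L.starProjection x = x := Submodule.starProjection_eq_self_iff.2 hx
    simp [this]
  · have hx : S' x ∈ L := by simp [L, hTS']
    rw [comp_apply, Submodule.starProjection_eq_self_iff.2 hx, hTS']

lemma exists_pseudoinverse {A : H₁ →L[ℂ] H₂} (hA : IsClosed (A.range : Set H₂)) :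
    ∃ B : H₂ →L[ℂ] H₁, ∀ x, A (B (A x)) = A x := by
  have : CompleteSpace A.ker := A.isClosed_ker.completeSpace_coe
  have : CompleteSpace A.range := hA.completeSpace_coe
  let V := A.kerᗮ
  let f : V →L[ℂ] A.range := (A ∘L V.subtypeL).codRestrict A.range fun x ↦ ⟨x, rfl⟩
  have hinj : f.ker = ⊥ := by
    rw [LinearMap.ker_eq_bot']
    rintro ⟨x, hx⟩ h
    have h' : x ∈ A.ker := congrArg Subtype.val h
    have := Submodule.inner_right_of_mem_orthogonal h' hx
    simpa using this
  have hsurj : f.range = ⊤ := by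
    rw [LinearMap.range_eq_top]
    rintro ⟨_, x, rfl⟩
    refine ⟨⟨x - A.ker.starProjection x, A.ker.sub_starProjection_mem_orthogonal x⟩, ?_⟩
    have : A (A.ker.starProjection x) = 0 := A.ker.starProjection_apply_mem x
    refine Subtype.ext (?_ : A (x - A.ker.starProjection x) = A x)
    rw [map_sub, this, sub_zero]
  let e := ContinuousLinearEquiv.ofBijective f hinj hsurj
  refine ⟨V.subtypeL ∘L e.symm.toContinuousLinearMap ∘L A.range.orthogonalProjectionOnto,
    fun x ↦ ?_⟩
  have h₁ : A.range.orthogonalProjectionOnto (A x) = ⟨A x, x, rfl⟩ :=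
    Submodule.orthogonalProjectionOnto_mem_subspace_eq_self (⟨A x, x, rfl⟩ : A.range)
  have h₂ := congrArg Subtype.val (e.apply_symm_apply ⟨A x, x, rfl⟩)
  simp only [comp_apply, h₁]
  exact h₂

lemma isClosed_range_adjoint {A : H₁ →L[ℂ] H₂} (hA : IsClosed (A.range : Set H₂)) :
    IsClosed ((adjoint A).range : Set H₁) := by
  obtain ⟨B, hB⟩ := exists_pseudoinverse hA
  have : A ∘L B ∘L A = A := by
    ext x
    exact hB x
  refine isClosed_range_of_pseudoinverse (B := adjoint B) fun x ↦ ?_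
  have h := congrArg adjoint this
  rw [adjoint_comp, adjoint_comp] at h
  exact congrArg (· x) h

lemma range_adjoint_eq_orthogonal_ker {A : H₁ →L[ℂ] H₂} (hA : IsClosed (A.range : Set H₂)) :
    (adjoint A).range = A.kerᗮ := by
  rw [A.orthogonal_ker, (isClosed_range_adjoint hA).submodule_topologicalClosure_eq]

lemma isClosed_range_of_finiteDimensional_relQuot_s11 {A : H₁ →L[ℂ] H₂} {M : Submodule ℂ H₂}
    (hM : IsClosed (M : Set H₂)) (hle : A.range ≤ M) (hfin : relLength M A.range ≠ ⊤) :
    IsClosed (A.range : Set H₂) := by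
  rw [relLength, length_ne_top_iff_finiteDimensional] at hfin
  have : CompleteSpace A.ker := A.isClosed_ker.completeSpace_coe
  have : CompleteSpace M := hM.completeSpace_coe
  let V := A.kerᗮ
  let f : V →L[ℂ] M := (A ∘L V.subtypeL).codRestrict M fun x ↦ hle ⟨x, rfl⟩
  have hinj : f.ker = ⊥ := by
    rw [LinearMap.ker_eq_bot']
    rintro ⟨x, hx⟩ h
    have h' : x ∈ A.ker := congrArg Subtype.val h
    have := Submodule.inner_right_of_mem_orthogonal h' hx
    simpa using this
  have hrange : f.range = (M ⊓ A.range).comap M.subtype := by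
    ext y
    constructor
    · rintro ⟨x, rfl⟩
      exact ⟨(f x).2, x, rfl⟩
    · rintro ⟨-, x, hx⟩
      refine ⟨⟨x - A.ker.starProjection x, A.ker.sub_starProjection_mem_orthogonal x⟩, ?_⟩
      have : A (A.ker.starProjection x) = 0 := A.ker.starProjection_apply_mem x
      refine Subtype.ext (?_ : A (x - A.ker.starProjection x) = y)
      rw [map_sub, this, sub_zero]
      exact hx
  have : FiniteDimensional ℂ (M ⧸ f.range) := by rwa [hrange]
  obtain ⟨G, hG⟩ := f.range.exists_isCompl
  have : FiniteDimensional ℂ G :=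
    (Submodule.quotientEquivOfIsCompl _ _ hG).finiteDimensional
  have hcl := closed_complemented_range_of_isCompl_of_ker_eq_bot f G hG
    G.closed_of_finiteDimensional hinj
  have := hM.isClosedEmbedding_subtypeVal.isClosedMap _ hcl
  convert this
  ext y
  rw [hrange]
  constructor
  · exact fun hy ↦ ⟨⟨y, hle hy⟩, ⟨hle hy, hy⟩, rfl⟩
  · rintro ⟨y, hy, rfl⟩
    exact hy.2

lemma apply_eq_zero_of_add_adjoint_apply_eq_zero {S : H₁ →L[ℂ] H₂} {T : H₂ →L[ℂ] H₁}
    (hTS : ∀ x, T (S x) = 0) {x : H₁} (hx : S x + adjoint T x = 0) :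
    S x = 0 ∧ adjoint T x = 0 := by
  have h : inner ℂ (S x) (adjoint T x) = 0 := by
    rw [adjoint_inner_right, hTS, inner_zero_left]
  have h₀ : S x = 0 := by
    rw [← inner_self_eq_zero (𝕜 := ℂ)]
    have := congrArg (inner ℂ (S x)) hx
    rwa [inner_add_right, h, add_zero, inner_zero_right] at this
  exact ⟨h₀, by rwa [h₀, zero_add] at hx⟩

/-- If `S T = 0`, `T S = 0` and `T` has closed range, then the pair `(S, T)` behaves like the single
operator `S + T†`. -/
lemma isFredholmPair_iff_add_adjoint {S : H₁ →L[ℂ] H₂} {T : H₂ →L[ℂ] H₁}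
    (hST : ∀ x, S (T x) = 0) (hTS : ∀ x, T (S x) = 0) (hT : IsClosed (T.range : Set H₁)) :
    (IsFredholmPair S T ↔ IsFredholmPair (S + adjoint T) (0 : H₂ →L[ℂ] H₁)) ∧
    (IsFredholmPair S T →
      pairIndex S T = pairIndex (S + adjoint T) (0 : H₂ →L[ℂ] H₁)) := by
  set D := S + adjoint T with hD
  have : CompleteSpace T.range := hT.completeSpace_coe
  have : CompleteSpace T.ker := T.isClosed_ker.completeSpace_coe
  have hkerD : ∀ x, x ∈ D.ker → S x = 0 ∧ adjoint T x = 0 := fun x hx ↦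
    apply_eq_zero_of_add_adjoint_apply_eq_zero hTS hx
  have h₁ : relLength S.ker T.range = relLength D.ker (0 : H₂ →L[ℂ] H₁).range := by
    refine length_quotient_eq (Submodule.inclusion fun x hx ↦ (hkerD x hx).1) _ _ ?_ ?_
    · rintro ⟨x, hx⟩
      constructor
      · rintro ⟨-, hxT⟩
        have hx' : x ∈ T.rangeᗮ := by
          rw [T.orthogonal_range]
          exact (hkerD x hx).2
        have h₀ : inner ℂ x x = 0 := Submodule.inner_right_of_mem_orthogonal hxT hx'
        rw [inner_self_eq_zero] at h₀
        exact ⟨hx, 0, by simp [h₀]⟩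
      · rintro ⟨-, y, hy⟩
        have h₀ : x = 0 := by simpa using hy.symm
        subst h₀
        exact ⟨(hkerD 0 hx).1, 0, map_zero T⟩
    · rintro ⟨y, hy⟩
      obtain ⟨z, hz⟩ := T.range.starProjection_apply_mem y
      have hz : T z = T.range.starProjection y := hz
      have hy' : y - T z ∈ T.rangeᗮ := by
        rw [hz]
        exact T.range.sub_starProjection_mem_orthogonal y
      rw [T.orthogonal_range] at hy'
      have hy' : adjoint T (y - T z) = 0 := hy'
      have hy : S y = 0 := hy
      have hS : S (y - T z) = 0 := by rw [map_sub, hy, hST, sub_zero]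
      have hmem : y - T z ∈ D.ker := by
        simp only [hD, LinearMap.mem_ker, coe_coe, add_apply, hS, hy', add_zero]
      exact ⟨⟨y - T z, hmem⟩, S.ker.sub_mem hy (hkerD _ hmem).1, z, (sub_sub_cancel y (T z)).symm⟩
  have h₂ : relLength T.range S.ker = 0 :=
    relLength_eq_zero (by rintro _ ⟨x, rfl⟩; exact hST x)
  have h₃ : relLength S.range T.ker = 0 :=
    relLength_eq_zero (by rintro _ ⟨x, rfl⟩; exact hTS x)
  have h₄ : relLength (0 : H₂ →L[ℂ] H₁).range D.ker = 0 :=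
    relLength_eq_zero (by rintro _ ⟨x, rfl⟩; simp)
  have h₅ : relLength D.range (0 : H₂ →L[ℂ] H₁).ker = 0 :=
    relLength_eq_zero fun x _ ↦ by simp
  have hTadj := range_adjoint_eq_orthogonal_ker hT
  have hrangeD : ∀ a b, S a + adjoint T b ∈ D.range := fun a b ↦ by
    obtain ⟨z, hz⟩ := T.range.starProjection_apply_mem (a - b)
    have hz : T z = T.range.starProjection (a - b) := hz
    have hy : a - b - T z ∈ T.rangeᗮ := by
      rw [hz]
      exact T.range.sub_starProjection_mem_orthogonal _
    rw [T.orthogonal_range] at hy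
    have hy : adjoint T (a - b - T z) = 0 := hy
    refine ⟨a - T z, ?_⟩
    have e : adjoint T (a - T z) = adjoint T b := by
      rw [← sub_eq_zero, ← map_sub, ← hy]
      congr 1
      abel
    rw [hD, coe_coe, add_apply, e, map_sub, hST, sub_zero]
  have h₆ : relLength (0 : H₂ →L[ℂ] H₁).ker D.range = relLength T.ker S.range := by
    refine length_quotient_eq (Submodule.inclusion fun x _ ↦ by simp) _ _ ?_ ?_
    · rintro ⟨x, hx⟩
      constructor
      · rintro ⟨-, y, hy⟩
        have hy : S y + adjoint T y = x := hy
        refine ⟨hx, y, ?_⟩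
        have h₁ : adjoint T y ∈ T.ker := by
          rw [eq_sub_of_add_eq' hy]
          exact T.ker.sub_mem hx (hTS y)
        have h₂ : adjoint T y ∈ T.kerᗮ := hTadj ▸ ⟨y, rfl⟩
        have h₀ : adjoint T y = 0 := by
          simpa using Submodule.inner_right_of_mem_orthogonal h₁ h₂
        rwa [h₀, add_zero] at hy
      · rintro ⟨-, y, hy⟩
        have hy : S y = x := hy
        refine ⟨by simp, ?_⟩
        simpa [hy] using hrangeD y 0
    · rintro ⟨y, -⟩
      have hy : y - T.ker.starProjection y ∈ T.kerᗮ := T.ker.sub_starProjection_mem_orthogonal y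
      rw [← hTadj] at hy
      obtain ⟨b, hb⟩ := hy
      refine ⟨⟨T.ker.starProjection y, T.ker.starProjection_apply_mem y⟩, by simp, ?_⟩
      have := hrangeD 0 b
      rw [map_zero, zero_add] at this
      have hb : adjoint T b = y - T.ker.starProjection y := hb
      rwa [hb] at this
  have hiff : IsFredholmPair S T ↔ IsFredholmPair D (0 : H₂ →L[ℂ] H₁) := by
    simp only [isFredholmPair_iff_commens, Commens, h₁, h₂, h₃, h₄, h₅, h₆]
  refine ⟨hiff, fun h ↦ ?_⟩
  simp only [h.pairIndex_eq, (hiff.1 h).pairIndex_eq, relIndex, h₁, h₂, h₃, h₄, h₅, h₆]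

lemma IsFredholmPair.isClosed_range_right {S : H₁ →L[ℂ] H₂} {T : H₂ →L[ℂ] H₁}
    (hST : ∀ x, S (T x) = 0) (h : IsFredholmPair S T) : IsClosed (T.range : Set H₁) :=
  isClosed_range_of_finiteDimensional_relQuot_s11 S.isClosed_ker
    (by rintro _ ⟨x, rfl⟩; exact hST x) (isFredholmPair_iff_commens.1 h).1.1

lemma IsFredholmPair.isClosed_range_of_add_adjoint {S : H₁ →L[ℂ] H₂} {T : H₂ →L[ℂ] H₁}
    (hTS : ∀ x, T (S x) = 0)
    (h : IsFredholmPair (S + adjoint T) (0 : H₂ →L[ℂ] H₁)) : IsClosed (T.range : Set H₁) := by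
  have : CompleteSpace T.ker := T.isClosed_ker.completeSpace_coe
  have hle : (adjoint T).range ≤ T.kerᗮ := by
    rw [T.orthogonal_ker]
    exact Submodule.le_topologicalClosure _
  suffices IsClosed ((adjoint T).range : Set H₂) by
    simpa using isClosed_range_adjoint this
  refine isClosed_range_of_finiteDimensional_relQuot_s11 T.ker.isClosed_orthogonal hle ?_
  refine ne_top_of_le_ne_top (isFredholmPair_iff_commens.1 h).2.1 ?_
  let P : H₂ →ₗ[ℂ] T.kerᗮ := T.kerᗮ.orthogonalProjectionOnto
  refine Module.length_le_of_surjective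
    (Submodule.mapQ _ _ (P ∘ₗ Submodule.subtype _) ?_) ?_
  · rintro ⟨_, -⟩ ⟨-, y, rfl⟩
    refine ⟨(P _).2, y, ?_⟩
    have hS : T.kerᗮ.starProjection (S y) = 0 := by
      rw [Submodule.starProjection_apply_eq_zero_iff]
      exact T.ker.le_orthogonal_orthogonal (hTS y)
    have hT : T.kerᗮ.starProjection (adjoint T y) = adjoint T y :=
      Submodule.starProjection_eq_self_iff.2 (hle ⟨y, rfl⟩)
    change adjoint T y = T.kerᗮ.starProjection (S y + adjoint T y)
    rw [map_add, hS, hT, zero_add]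
  · intro c
    induction c using Submodule.Quotient.induction_on with
    | _ z =>
      refine ⟨Submodule.Quotient.mk ⟨z, by simp⟩, ?_⟩
      rw [Submodule.mapQ_apply]
      congr 1
      exact Submodule.orthogonalProjectionOnto_mem_subspace_eq_self z

/-- Finite rank of both compositions suffices to compare `(S, T)` with `S + T†`. -/
lemma isFredholmPair_iff_add_adjoint_of_finiteDimensional {S : H₁ →L[ℂ] H₂} {T : H₂ →L[ℂ] H₁}
    (hTS : FiniteDimensional ℂ (T ∘L S).range) (hST : FiniteDimensional ℂ (S ∘L T).range) :
    (IsFredholmPair S T ↔ IsFredholmPair (S + adjoint T) (0 : H₂ →L[ℂ] H₁)) ∧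
    (IsFredholmPair S T →
      pairIndex S T = pairIndex (S + adjoint T) (0 : H₂ →L[ℂ] H₁)) := by
  obtain ⟨S', T', hS, hT, hST', hTS'⟩ := exists_comp_eq_zero hTS hST
  have hD : FiniteDimensional ℂ ((S' + adjoint T') - (S + adjoint T)).range := by
    have e : (S' + adjoint T') - (S + adjoint T) = - ((S - S') + adjoint (T - T')) := by
      rw [map_sub]
      abel
    have h := finiteDimensional_range_add hS (finiteDimensional_range_adjoint hT)
    rw [e, toLinearMap_neg, LinearMap.range_neg]
    exact h
  have h0 : FiniteDimensional ℂ ((0 : H₂ →L[ℂ] H₁) - 0).range :=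
    finiteDimensional_range_of_range_le (p := ⊥) (by simp)
  have hS' : FiniteDimensional ℂ (S' - S).range := by
    rwa [← neg_sub, toLinearMap_neg, LinearMap.range_neg]
  have hT' : FiniteDimensional ℂ (T' - T).range := by
    rwa [← neg_sub, toLinearMap_neg, LinearMap.range_neg]
  have hD' : FiniteDimensional ℂ ((S + adjoint T) - (S' + adjoint T')).range := by
    rwa [← neg_sub, toLinearMap_neg, LinearMap.range_neg]
  have key : IsFredholmPair S T → IsFredholmPair (S + adjoint T) (0 : H₂ →L[ℂ] H₁) ∧
      pairIndex S T = pairIndex (S + adjoint T) (0 : H₂ →L[ℂ] H₁) := fun h ↦ by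
    obtain ⟨h₁, e₁⟩ := h.of_finiteDimensional_range_sub hS hT
    obtain ⟨hiff, hidx⟩ := isFredholmPair_iff_add_adjoint hST' hTS' (h₁.isClosed_range_right hST')
    obtain ⟨h₂, e₂⟩ := (hiff.1 h₁).of_finiteDimensional_range_sub hD h0
    exact ⟨h₂, by rw [e₁, hidx h₁, e₂]⟩
  refine ⟨⟨fun h ↦ (key h).1, fun h ↦ ?_⟩, fun h ↦ (key h).2⟩
  obtain ⟨h₁, -⟩ := h.of_finiteDimensional_range_sub hD' h0
  have h₂ := (isFredholmPair_iff_add_adjoint hST' hTS'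
    (h₁.isClosed_range_of_add_adjoint hTS')).1.2 h₁
  exact (h₂.of_finiteDimensional_range_sub hS' hT').1

/-- Stability of the index of a single Fredholm operator under small perturbations. -/
lemma IsFredholmPair.exists_stable_of_zero {D : H₁ →L[ℂ] H₂}
    (h : IsFredholmPair D (0 : H₂ →L[ℂ] H₁)) :
    ∃ ε > (0 : ℝ), ∀ D₁ : H₁ →L[ℂ] H₂, ‖D₁ - D‖ < ε →
      IsFredholmPair D₁ (0 : H₂ →L[ℂ] H₁) ∧
        pairIndex D (0 : H₂ →L[ℂ] H₁) = pairIndex D₁ (0 : H₂ →L[ℂ] H₁) := by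
  have hrange : relLength ⊤ D.range ≠ ⊤ := by
    have := (isFredholmPair_iff_commens.1 h).2.1
    rwa [show (0 : H₂ →L[ℂ] H₁).ker = ⊤ by ext; simp] at this
  have hcl : IsClosed (D.range : Set H₂) :=
    isClosed_range_of_finiteDimensional_relQuot_s11 isClosed_univ le_top hrange
  have hker : FiniteDimensional ℂ D.ker := by
    have := (isFredholmPair_iff_commens.1 h).1.1
    rw [show (0 : H₂ →L[ℂ] H₁).range = ⊥ by ext; simp,
      relLength_bot, length_ne_top_iff_finiteDimensional] at this
    exact this
  obtain ⟨E, hE⟩ := exists_pseudoinverse hcl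
  let Q := ContinuousLinearMap.id ℂ H₂ - D ∘L E
  have hQ : FiniteDimensional ℂ Q.range := by
    rw [← length_ne_top_iff_finiteDimensional]
    have hK : relLength ⊤ D.range = relLength Q.ker D.range + _ := relLength_top_eq Q.toLinearMap _
    rw [show D.range.map Q.toLinearMap = ⊥ by
      rw [eq_bot_iff]; rintro _ ⟨_, ⟨x, rfl⟩, rfl⟩; simp [Q, hE]] at hK
    rw [hK, relLength_bot] at hrange
    exact (not_or.1 (mt WithTop.add_eq_top.2 hrange)).2
  obtain ⟨ε, hε, hunit⟩ : ∃ ε > (0 : ℝ), ∀ Δ : H₁ →L[ℂ] H₂, ‖Δ‖ < ε →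
      Function.Bijective (ContinuousLinearMap.id ℂ H₁ + E ∘L Δ ∘L E ∘L D) := by
    have hopen : IsOpen {U : H₁ →L[ℂ] H₁ | IsUnit U} := Units.isOpen
    have hcont : Continuous fun Δ : H₁ →L[ℂ] H₂ ↦
        ContinuousLinearMap.id ℂ H₁ + E ∘L Δ ∘L E ∘L D := by fun_prop
    obtain ⟨ε, hε, hb⟩ := Metric.isOpen_iff.1 (hopen.preimage hcont) 0
      (by simp only [Set.mem_preimage, zero_comp, comp_zero, add_zero]; exact isUnit_one)
    exact ⟨ε, hε, fun Δ hΔ ↦ ContinuousLinearMap.isUnit_iff_bijective.1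
      (hb (by simpa using hΔ))⟩
  refine ⟨ε, hε, fun D₁ hD₁ ↦ ?_⟩
  set Δ := D₁ - D with hΔ
  let U := ContinuousLinearMap.id ℂ H₁ + E ∘L Δ ∘L E ∘L D
  have hU : Function.Bijective U := hunit Δ hD₁
  have hUker : ∀ x, D x = 0 → U x = x := fun x hx ↦ by simp [U, hx]
  have hkerU : (D ∘L U).ker = D.ker := by
    ext x
    constructor
    · intro hx
      have := hU.1 (hUker (U x) hx)
      rwa [← this]
    · intro hx
      have hx : D x = 0 := hx
      simp [hUker x hx, hx]
  have hrangeU : (D ∘L U).range = D.range := by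
    ext y
    constructor
    · rintro ⟨x, rfl⟩
      exact ⟨U x, rfl⟩
    · rintro ⟨x, rfl⟩
      obtain ⟨z, rfl⟩ := hU.2 x
      exact ⟨z, rfl⟩
  have hDU : IsFredholmPair (D ∘L U) (0 : H₂ →L[ℂ] H₁) := by
    rwa [isFredholmPair_iff_commens, hkerU, hrangeU, ← isFredholmPair_iff_commens]
  have hidx : pairIndex D (0 : H₂ →L[ℂ] H₁) = pairIndex (D ∘L U) (0 : H₂ →L[ℂ] H₁) := by
    rw [h.pairIndex_eq, hDU.pairIndex_eq, hkerU, hrangeU]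
  have hfin : FiniteDimensional ℂ (D ∘L U - D₁).range := by
    let P := ContinuousLinearMap.id ℂ H₁ - E ∘L D
    have hP : FiniteDimensional ℂ P.range :=
      finiteDimensional_range_of_range_le (p := D.ker) fun x ↦ by simp [P, hE]
    have e : D ∘L U - D₁ = (-(Q ∘L Δ ∘L E ∘L D)) - Δ ∘L P := by
      ext x
      simp only [Q, P, U, sub_apply, neg_apply, comp_apply, add_apply, id_apply, map_add, map_sub]
      rw [show D₁ x = Δ x + D x by simp [hΔ]]
      abel
    rw [e]
    refine finiteDimensional_range_sub (finiteDimensional_range_of_range_le (p := Q.range)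
      fun x ↦ Q.range.neg_mem ⟨_, rfl⟩) ?_
    exact finiteDimensional_range_of_range_le (p := P.range.map Δ.toLinearMap)
      fun x ↦ ⟨P x, ⟨x, rfl⟩, rfl⟩
  obtain ⟨h₁, e₁⟩ := hDU.of_finiteDimensional_range_sub_left hfin
  exact ⟨h₁, hidx.trans e₁⟩

end Hilbert

variable {H₁ H₂ : Type*} [NormedAddCommGroup H₁] [InnerProductSpace ℂ H₁] [CompleteSpace H₁]
  [NormedAddCommGroup H₂] [InnerProductSpace ℂ H₂] [CompleteSpace H₂]

theorem fredholm_pair_stability (S : H₁ →L[ℂ] H₂) (T : H₂ →L[ℂ] H₁)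
    (h : IsFredholmPair S T) :
    ∃ ε > (0 : ℝ), ∀ (S₁ : H₁ →L[ℂ] H₂) (T₁ : H₂ →L[ℂ] H₁),
      FiniteDimensional ℂ (LinearMap.range (T₁ ∘L S₁).toLinearMap) →
      FiniteDimensional ℂ (LinearMap.range (S₁ ∘L T₁).toLinearMap) →
      ‖S - S₁‖ < ε → ‖T - T₁‖ < ε →
      IsFredholmPair S₁ T₁ ∧ pairIndex S T = pairIndex S₁ T₁ := by
  have h' := isFredholmPair_iff_commens.1 h
  obtain ⟨hiff, hidx⟩ := isFredholmPair_iff_add_adjoint_of_finiteDimensional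
    (finiteDimensional_range_comp_of_relLength h'.2.2)
    (finiteDimensional_range_comp_of_relLength h'.1.2)
  obtain ⟨ε, hε, hstable⟩ := (hiff.1 h).exists_stable_of_zero
  refine ⟨ε / 2, half_pos hε, fun S₁ T₁ hTS hST hS hT ↦ ?_⟩
  obtain ⟨hiff₁, hidx₁⟩ := isFredholmPair_iff_add_adjoint_of_finiteDimensional hTS hST
  have hnorm : ‖(S₁ + adjoint T₁) - (S + adjoint T)‖ < ε := by
    have e : (S₁ + adjoint T₁) - (S + adjoint T) = -((S - S₁) + adjoint (T - T₁)) := by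
      rw [map_sub]
      abel
    rw [e, norm_neg]
    refine (norm_add_le _ _).trans_lt ?_
    rw [LinearIsometryEquiv.norm_map]
    linarith
  obtain ⟨hD, heq⟩ := hstable _ hnorm
  have h₁ := hiff₁.2 hD
  exact ⟨h₁, by rw [hidx h, heq, hidx₁ h₁]⟩
end
end

section
/- Let (H,δ) be a chain of Hilbert spaces H_p and bounded operators δ_p ∈ L(H_p,H_{p−1}), p ∈ ℤ, with H_p = 0 and δ_p = 0 for p < 0 and p ≥ n+1. Let H⁽¹⁾ = ⊕_{p even} H_p and H⁽²⁾ = ⊕_{p odd} H_p be the orthogonal Hilbert direct sums, and let S = ⊕_{p even} δ_p ∈ L(H⁽¹⁾,H⁽²⁾) and T = ⊕_{p odd} δ_p ∈ L(H⁽²⁾,H⁽¹⁾). Then (H,δ) is a Fredholm chain if and only if (S,T) is a Fredholm pair, and in this case ind(H,δ) = ind(S,T). -/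
open Module ContinuousLinearMap

noncomputable section

set_option maxHeartbeats 1000000
set_option synthInstance.maxHeartbeats 1000000

section ChainDefs

variable (H : ℤ → Type*) [∀ p, NormedAddCommGroup (H p)] [∀ p, InnerProductSpace ℂ (H p)]

/-- The identification `H p ≃ H q` coming from an equality of indices `p = q`. -/
def fcast {p q : ℤ} (h : p = q) : H p ≃ₗᵢ[ℂ] H q := by
  subst h; exact LinearIsometryEquiv.refl ℂ (H p)

/-- The identification `H p ≃ H q` as a continuous linear map. -/
def fcastL {p q : ℤ} (h : p = q) : H p →L[ℂ] H q :=
  (fcast H h).toLinearIsometry.toContinuousLinearMap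

variable (δ : ∀ p : ℤ, H p →L[ℂ] H (p - 1))

/-- The range of `δ (p+1)` viewed as a subspace of `H p`. -/
def chainRange (p : ℤ) : Submodule ℂ (H p) :=
  Submodule.map (fcastL H (show p + 1 - 1 = p by ring)).toLinearMap (LinearMap.range (δ (p + 1)).toLinearMap)

/-- The composition `δ p ∘ δ (p+1) : H (p+1) → H (p-1)`. -/
def chainComp (p : ℤ) : H (p + 1) →L[ℂ] H (p - 1) :=
  δ p ∘L (fcastL H (show p + 1 - 1 = p by ring) ∘L δ (p + 1))

/-- `(H, δ)` is a Fredholm chain if `N(δ p)/(N(δ p) ⊓ R(δ (p+1)))` and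
`R(δ (p+1))/(N(δ p) ⊓ R(δ (p+1)))` are finite dimensional for every `p ∈ ℤ`. -/
def IsFredholmChain : Prop :=
  ∀ p : ℤ, FiniteDimensional ℂ (relQuot (LinearMap.ker (δ p).toLinearMap) (chainRange H δ p)) ∧
    FiniteDimensional ℂ (relQuot (chainRange H δ p) (LinearMap.ker (δ p).toLinearMap))

/-- The index of a Fredholm chain supported on `0, …, n`:
`ind (H,δ) = ∑ (-1)^p (dim N(δ p)/(N(δ p) ⊓ R(δ (p+1))) - dim R(δ (p+1))/(N(δ p) ⊓ R(δ (p+1))))`. -/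
def chainIndex (n : ℕ) : ℤ :=
  ∑ j ∈ Finset.range (n + 1), (-1 : ℤ) ^ j *
    ((finrank ℂ (relQuot (LinearMap.ker (δ (j : ℤ)).toLinearMap) (chainRange H δ (j : ℤ))) : ℤ)
      - (finrank ℂ (relQuot (chainRange H δ (j : ℤ)) (LinearMap.ker (δ (j : ℤ)).toLinearMap)) : ℤ))

end ChainDefs

section LpSubmodules

variable {ι : Type*} {G : ι → Type*} [∀ i, NormedAddCommGroup (G i)]

theorem memℓp_of_subsingleton_compl {s : Finset ι} (hs : ∀ i ∉ s, Subsingleton (G i))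
    (f : ∀ i, G i) : Memℓp f 2 := by
  refine (memℓp_zero (s.finite_toSet.subset fun i hi => ?_)).of_exponent_ge zero_le
  by_contra his
  have := hs i his
  exact hi (Subsingleton.elim _ _)

variable [∀ i, InnerProductSpace ℂ (G i)]

/-- Relative quotients of submodules of a Hilbert sum with finitely many nontrivial summands are
computed summand by summand. -/
theorem nonempty_relQuot_equiv_pi {s : Finset ι} (hs : ∀ i ∉ s, Subsingleton (G i))
    {P Q : Submodule ℂ (lp G 2)} {p q : ∀ i, Submodule ℂ (G i)}
    (hP : ∀ x, x ∈ P ↔ ∀ i, x i ∈ p i) (hQ : ∀ x, x ∈ Q ↔ ∀ i, x i ∈ q i) :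
    Nonempty (relQuot P Q ≃ₗ[ℂ] ∀ i : s, relQuot (p i) (q i)) := by
  let φ : P →ₗ[ℂ] ∀ i : s, relQuot (p i) (q i) := LinearMap.pi fun i =>
    ((p i ⊓ q i).comap (p i).subtype).mkQ ∘ₗ
      { toFun := fun x => ⟨x.1 i, (hP x.1).1 x.2 i⟩
        map_add' := fun _ _ => rfl
        map_smul' := fun _ _ => rfl }
  have hφ (x : P) (i : s) : φ x i = Submodule.Quotient.mk ⟨x.1 i, (hP x.1).1 x.2 i⟩ := rfl
  have hsurj : Function.Surjective φ := by
    classical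
    intro z
    choose w hw using fun i : s => Submodule.Quotient.mk_surjective _ (z i)
    let f : ∀ i, G i := fun i => if h : i ∈ s then (w ⟨i, h⟩).1 else 0
    let x : lp G 2 := ⟨f, memℓp_of_subsingleton_compl hs f⟩
    have hx (i : s) : x i = (w i).1 := dif_pos i.2
    have hxP : x ∈ P := (hP x).2 fun i => by
      by_cases h : i ∈ s
      · rw [hx ⟨i, h⟩]
        exact (w ⟨i, h⟩).2
      · have := hs i h
        rw [Subsingleton.elim (x i) 0]
        exact zero_mem _
    refine ⟨⟨x, hxP⟩, funext fun i => ?_⟩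
    rw [hφ, ← hw i]
    exact congrArg _ (Subtype.ext (hx i))
  have hker : (P ⊓ Q).comap P.subtype = LinearMap.ker φ := by
    ext x
    have hx : x ∈ LinearMap.ker φ ↔ ∀ i : s, x.1 i ∈ q i := by
      rw [LinearMap.mem_ker, funext_iff]
      refine forall_congr' fun i => ?_
      rw [hφ, Pi.zero_apply, Submodule.Quotient.mk_eq_zero]
      exact ⟨fun h => h.2, fun h => ⟨(hP x.1).1 x.2 i, h⟩⟩
    rw [hx]
    refine ⟨fun h i => (hQ x.1).1 h.2 i, fun h => ⟨x.2, (hQ x.1).2 fun i => ?_⟩⟩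
    by_cases hi : i ∈ s
    · exact h ⟨i, hi⟩
    · have := hs i hi
      rw [Subsingleton.elim (x.1 i) 0]
      exact zero_mem _
  exact ⟨(Submodule.quotEquivOfEq _ _ hker).trans (φ.quotKerEquivOfSurjective hsurj)⟩

theorem finiteDimensional_relQuot_lp_iff {s : Finset ι} (hs : ∀ i ∉ s, Subsingleton (G i))
    {P Q : Submodule ℂ (lp G 2)} {p q : ∀ i, Submodule ℂ (G i)}
    (hP : ∀ x, x ∈ P ↔ ∀ i, x i ∈ p i) (hQ : ∀ x, x ∈ Q ↔ ∀ i, x i ∈ q i) :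
    FiniteDimensional ℂ (relQuot P Q) ↔ ∀ i, FiniteDimensional ℂ (relQuot (p i) (q i)) := by
  obtain ⟨e⟩ := nonempty_relQuot_equiv_pi hs hP hQ
  constructor
  · intro h i
    by_cases hi : i ∈ s
    · have := Module.Finite.equiv e
      exact Module.Finite.of_surjective
        (LinearMap.proj (R := ℂ) (φ := fun i : s => relQuot (p i) (q i)) ⟨i, hi⟩)
        (LinearMap.proj_surjective _)
    · have := hs i hi
      infer_instance
  · intro h
    exact Module.Finite.equiv e.symm

theorem finrank_relQuot_lp {s : Finset ι} (hs : ∀ i ∉ s, Subsingleton (G i))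
    {P Q : Submodule ℂ (lp G 2)} {p q : ∀ i, Submodule ℂ (G i)}
    (hP : ∀ x, x ∈ P ↔ ∀ i, x i ∈ p i) (hQ : ∀ x, x ∈ Q ↔ ∀ i, x i ∈ q i)
    (h : ∀ i, FiniteDimensional ℂ (relQuot (p i) (q i))) :
    finrank ℂ (relQuot P Q) = ∑ i ∈ s, finrank ℂ (relQuot (p i) (q i)) := by
  obtain ⟨e⟩ := nonempty_relQuot_equiv_pi hs hP hQ
  rw [e.finrank_eq, Module.finrank_pi_fintype,
    Finset.sum_coe_sort s fun i => finrank ℂ (relQuot (p i) (q i))]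

end LpSubmodules

theorem mem_chainRange_iff (H : ℤ → Type*) [∀ p, NormedAddCommGroup (H p)]
    [∀ p, InnerProductSpace ℂ (H p)] (δ : ∀ p : ℤ, H p →L[ℂ] H (p - 1)) {p q : ℤ}
    (h : q - 1 = p) (x : H p) :
    x ∈ chainRange H δ p ↔ ∃ z : H q, fcast H h (δ q z) = x := by
  obtain rfl : q = p + 1 := by omega
  constructor
  · rintro ⟨_, ⟨z, rfl⟩, rfl⟩
    exact ⟨z, rfl⟩
  · rintro ⟨z, rfl⟩
    exact ⟨_, ⟨z, rfl⟩, rfl⟩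

theorem sum_range_alternating_eq (f : ℤ → ℤ) (N : ℕ) :
    ∑ k ∈ Finset.range N, (f (2 * k) - f (2 * k - 1)) =
      ∑ j ∈ Finset.range (2 * N), (-1 : ℤ) ^ (j + 1) * f (j - 1) := by
  induction N with
  | zero => simp
  | succ N ih =>
    rw [Finset.sum_range_succ, ih, mul_add, mul_one, Finset.sum_range_succ, Finset.sum_range_succ]
    have h1 : (-1 : ℤ) ^ (2 * N + 1) = -1 := Odd.neg_one_pow ⟨N, rfl⟩
    have h2 : (-1 : ℤ) ^ (2 * N + 1 + 1) = 1 := Even.neg_one_pow ⟨N + 1, by ring⟩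
    rw [h1, h2]
    push_cast
    rw [add_sub_cancel_right]
    ring

theorem sum_alternating_eq_sum_even_sub_sum_odd (f : ℤ → ℤ) (n : ℕ)
    (hf : ∀ p : ℤ, (p < 0 ∨ (n : ℤ) + 1 ≤ p) → f p = 0) :
    ∑ j ∈ Finset.range (n + 1), (-1 : ℤ) ^ j * f j =
      ∑ k ∈ Finset.range (n + 1), f (2 * k) - ∑ k ∈ Finset.range (n + 1), f (2 * k - 1) := by
  rw [← Finset.sum_sub_distrib, sum_range_alternating_eq,
    show 2 * (n + 1) = 2 * n + 1 + 1 by ring, Finset.sum_range_succ' _ (2 * n + 1), Nat.cast_zero,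
    hf (0 - 1) (by omega), mul_zero, add_zero]
  refine Finset.sum_subset_zero_on_sdiff (Finset.range_subset_range.2 (by omega)) ?_ ?_
  · intro j hj
    simp only [Finset.mem_sdiff, Finset.mem_range] at hj
    rw [hf _ (by omega), mul_zero]
  · intro j _
    rw [pow_succ, pow_succ]
    push_cast
    rw [add_sub_cancel_right]
    ring

theorem fredholm_chain_iff_fredholm_pair (H : ℤ → Type) [∀ p, NormedAddCommGroup (H p)]
    [∀ p, InnerProductSpace ℂ (H p)] [∀ p, CompleteSpace (H p)] (n : ℕ)
    (hzero : ∀ p : ℤ, (p < 0 ∨ (n : ℤ) + 1 ≤ p) → Subsingleton (H p))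
    (δ : ∀ p : ℤ, H p →L[ℂ] H (p - 1))
    (S : lp (fun k : ℤ => H (2 * k)) 2 →L[ℂ] lp (fun k : ℤ => H (2 * k - 1)) 2)
    (T : lp (fun k : ℤ => H (2 * k - 1)) 2 →L[ℂ] lp (fun k : ℤ => H (2 * k)) 2)
    (hS : ∀ (x : lp (fun k : ℤ => H (2 * k)) 2) (k : ℤ), S x k = δ (2 * k) (x k))
    (hT : ∀ (y : lp (fun k : ℤ => H (2 * k - 1)) 2) (k : ℤ),
      T y (k - 1) = fcast H (show 2 * k - 1 - 1 = 2 * (k - 1) by ring) (δ (2 * k - 1) (y k))) :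
    (IsFredholmChain H δ ↔ IsFredholmPair S T) ∧
    (IsFredholmChain H δ → chainIndex H δ n = pairIndex S T) := by
  let s : Finset ℤ := (Finset.range (n + 1)).map Nat.castEmbedding
  have hmem (k : ℤ) (h0 : 0 ≤ k) (hn : k ≤ n) : k ∈ s :=
    Finset.mem_map.2 ⟨k.toNat, Finset.mem_range.2 (by omega), Int.toNat_of_nonneg h0⟩
  have hs0 : ∀ k ∉ s, Subsingleton (H (2 * k)) := fun k hk =>
    hzero _ (by by_contra h; exact hk (hmem k (by omega) (by omega)))
  have hs1 : ∀ k ∉ s, Subsingleton (H (2 * k - 1)) := fun k hk =>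
    hzero _ (by by_contra h; exact hk (hmem k (by omega) (by omega)))
  have hkerS : ∀ x, x ∈ LinearMap.ker S.toLinearMap ↔
      ∀ k, x k ∈ LinearMap.ker (δ (2 * k)).toLinearMap := fun x => by
    rw [LinearMap.mem_ker, lp.ext_iff, funext_iff]
    refine forall_congr' fun k => ?_
    rw [LinearMap.mem_ker]
    exact iff_of_eq (congrArg (· = 0) (hS x k))
  have hkerT : ∀ y, y ∈ LinearMap.ker T.toLinearMap ↔
      ∀ k, y k ∈ LinearMap.ker (δ (2 * k - 1)).toLinearMap := fun y => by
    rw [LinearMap.mem_ker, lp.ext_iff, funext_iff, ← (Equiv.subRight (1 : ℤ)).forall_congr_right]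
    refine forall_congr' fun k => ?_
    rw [LinearMap.mem_ker]
    exact (iff_of_eq (congrArg (· = 0) (hT y k))).trans (LinearIsometryEquiv.map_eq_zero_iff _)
  have hranS : ∀ y, y ∈ LinearMap.range S.toLinearMap ↔
      ∀ k, y k ∈ chainRange H δ (2 * k - 1) := fun y => by
    constructor
    · rintro ⟨x, rfl⟩ k
      exact (mem_chainRange_iff H δ (q := 2 * k) rfl _).2 ⟨x k, (hS x k).symm⟩
    · intro h
      choose z hz using fun k => (mem_chainRange_iff H δ (q := 2 * k) rfl _).1 (h k)
      refine ⟨⟨z, memℓp_of_subsingleton_compl hs0 z⟩, lp.ext (funext fun k => ?_)⟩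
      exact (hS _ k).trans (hz k)
  have hranT : ∀ x, x ∈ LinearMap.range T.toLinearMap ↔
      ∀ k, x k ∈ chainRange H δ (2 * k) := fun x => by
    rw [← (Equiv.subRight (1 : ℤ)).forall_congr_right]
    have hidx (k : ℤ) : 2 * k - 1 - 1 = 2 * (k - 1) := by ring
    constructor
    · rintro ⟨y, rfl⟩ k
      exact (mem_chainRange_iff H δ (hidx k) _).2 ⟨y k, (hT y k).symm⟩
    · intro h
      choose z hz using fun k => (mem_chainRange_iff H δ (hidx k) _).1 (h k)
      refine ⟨⟨z, memℓp_of_subsingleton_compl hs1 z⟩, lp.ext (funext ?_)⟩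
      rw [← (Equiv.subRight (1 : ℤ)).forall_congr_right]
      exact fun k => (hT _ k).trans (hz k)
  constructor
  · unfold IsFredholmPair
    rw [finiteDimensional_relQuot_lp_iff hs0 hkerS hranT,
      finiteDimensional_relQuot_lp_iff hs0 hranT hkerS,
      finiteDimensional_relQuot_lp_iff hs1 hkerT hranS,
      finiteDimensional_relQuot_lp_iff hs1 hranS hkerT]
    refine ⟨fun h => ⟨fun k => (h _).1, fun k => (h _).2, fun k => (h _).1, fun k => (h _).2⟩, ?_⟩
    rintro ⟨h1, h2, h3, h4⟩ p
    obtain ⟨k, rfl | rfl⟩ : ∃ k, p = 2 * k ∨ p = 2 * k - 1 := ⟨(p + 1) / 2, by omega⟩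
    · exact ⟨h1 k, h2 k⟩
    · exact ⟨h3 k, h4 k⟩
  · intro h
    unfold chainIndex pairIndex
    rw [finrank_relQuot_lp hs0 hkerS hranT fun k => (h _).1,
      finrank_relQuot_lp hs0 hranT hkerS fun k => (h _).2,
      finrank_relQuot_lp hs1 hkerT hranS fun k => (h _).1,
      finrank_relQuot_lp hs1 hranS hkerT fun k => (h _).2]
    rw [sum_alternating_eq_sum_even_sub_sum_odd (fun p =>
      (finrank ℂ (relQuot (LinearMap.ker (δ p).toLinearMap) (chainRange H δ p)) : ℤ)
      - (finrank ℂ (relQuot (chainRange H δ p) (LinearMap.ker (δ p).toLinearMap)) : ℤ)) n]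
    · simp only [s, Finset.sum_map, Finset.sum_sub_distrib, Nat.cast_sum]
      have hregroup (a b c d : ℤ) : a - b - (c - d) = a - b - c + d := by ring
      exact hregroup _ _ _ _
    · intro p hp
      have := hzero p hp
      simp only [finrank_zero_of_subsingleton, sub_self]
end
end
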